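/- arXiv:1706.08326 — 5 statements merged into one kernel-verified Lean document; each statement's English description precedes it below -/
import Mathlib

section
/- Let B be a unital C*-algebra, let A be a C*-subalgebra of B containing the unit 1 of B, and let T : A → B be a continuous linear map which is a triple derivation at the unit 1. Then T is a generalized derivation, that is, T(xy) = T(x)y + xT(y) − xT(1)y for all x, y ∈ A. -/
/-- The C*-triple product `{a,b,c} = (1/2)(a b* c + c b* a)`. -/
noncomputable def trip {R : Type*} [NonUnitalRing R] [Module ℂ R] [Star R] (a b c : R) : R :=
  (2 : ℂ)⁻¹ • (a * star b * c + c * star b * a)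

section CStarCancel

variable {B : Type*} [NonUnitalNormedRing B] [StarRing B] [CStarRing B]

lemma mul_eq_zero_of_mul_star_mul_self_left {k m : B} (h : k * star k * k * m = 0) :
    k * m = 0 := by
  have h' : star k * k * m = 0 := by
    rw [← CStarRing.star_mul_self_eq_zero_iff]
    calc star (star k * k * m) * (star k * k * m)
        = star m * star k * (k * star k * k * m) := by
          simp only [star_mul, star_star, mul_assoc]
      _ = 0 := by rw [h, mul_zero]
  rw [← CStarRing.star_mul_self_eq_zero_iff]
  calc star (k * m) * (k * m) = star m * (star k * k * m) := by
        simp only [star_mul, mul_assoc]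
    _ = 0 := by rw [h', mul_zero]

lemma mul_eq_zero_of_mul_star_mul_self_right {k m : B} (h : m * (k * star k * k) = 0) :
    m * k = 0 := by
  rw [← star_eq_zero, star_mul]
  apply mul_eq_zero_of_mul_star_mul_self_left
  rw [← star_eq_zero]
  simpa only [star_mul, star_star, mul_assoc] using h

end CStarCancel

/-- A real cube root, defined on all of `ℝ`, as a continuous function. -/
lemma exists_continuous_cube_root : ∃ f : ℝ → ℝ, Continuous f ∧ ∀ x, f x ^ 3 = x := by
  refine ⟨fun x ↦ (max x 0) ^ (1 / 3 : ℝ) - (max (-x) 0) ^ (1 / 3 : ℝ), ?_, fun x ↦ ?_⟩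
  · refine Continuous.sub ?_ ?_
    · exact (continuous_id.max continuous_const).rpow_const fun _ ↦ Or.inr (by norm_num)
    · exact (continuous_neg.max continuous_const).rpow_const fun _ ↦ Or.inr (by norm_num)
  · have key : ∀ y : ℝ, 0 ≤ y → (y ^ (1 / 3 : ℝ)) ^ 3 = y := fun y hy ↦ by
      rw [← Real.rpow_natCast, ← Real.rpow_mul hy]; norm_num
    have h0 : (0 : ℝ) ^ (1 / 3 : ℝ) = 0 := Real.zero_rpow (by norm_num)
    rcases le_total 0 x with hx | hx
    · simp only [max_eq_left hx, max_eq_right (neg_nonpos.2 hx), h0, sub_zero, key x hx]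
    · simp only [max_eq_right hx, max_eq_left (neg_nonneg.2 hx), h0, zero_sub]
      rw [Odd.neg_pow (by decide), key _ (neg_nonneg.2 hx), neg_neg]

lemma IsSelfAdjoint.exists_cube_root {A : Type*} [CStarAlgebra A] {k : A}
    (hk : IsSelfAdjoint k) : ∃ h : A, IsSelfAdjoint h ∧ h * h * h = k := by
  obtain ⟨f, hf, hf3⟩ := exists_continuous_cube_root
  refine ⟨cfc f k, cfc_predicate f k, ?_⟩
  rw [← pow_three', ← cfc_pow f 3 k hf.continuousOn hk]
  simp only [hf3]
  exact cfc_id' ℝ k hk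

section JordanDerivation

open scoped ComplexStarModule

variable {A B : Type*} [CStarAlgebra A] [CStarAlgebra B]

/-- The failure of `D` to satisfy the Leibniz rule at `(a, b)`, where `A` acts on `B` through
`π`. -/
noncomputable def leibnizDefect (π : A →⋆ₐ[ℂ] B) (D : A →ₗ[ℂ] B) (a b : A) : B :=
  D (a * b) - D a * π b - π a * D b

/-- `D` is a Jordan derivation, where `A` acts on `B` through `π`. -/
def IsJordanDerivation (π : A →⋆ₐ[ℂ] B) (D : A →ₗ[ℂ] B) : Prop :=
  ∀ x, D (x * x) = D x * π x + π x * D x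

/-- `k` annihilates, from both sides, the `A`-bimodule generated by the Leibniz defects of `D`. -/
def AnnihilatesDefect (π : A →⋆ₐ[ℂ] B) (D : A →ₗ[ℂ] B) (k : A) : Prop :=
  ∀ a b x, leibnizDefect π D a b * π x * π k = 0 ∧ π k * π x * leibnizDefect π D a b = 0

variable {π : A →⋆ₐ[ℂ] B} {D : A →ₗ[ℂ] B}

lemma leibnizDefect_add_left (a b c : A) :
    leibnizDefect π D (a + b) c = leibnizDefect π D a c + leibnizDefect π D b c := by
  simp only [leibnizDefect, add_mul, map_add]
  abel

lemma leibnizDefect_add_right (a b c : A) :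
    leibnizDefect π D a (b + c) = leibnizDefect π D a b + leibnizDefect π D a c := by
  simp only [leibnizDefect, mul_add, map_add]
  abel

lemma leibnizDefect_smul_left (t : ℂ) (a b : A) :
    leibnizDefect π D (t • a) b = t • leibnizDefect π D a b := by
  simp only [leibnizDefect, smul_mul_assoc, map_smul, smul_sub]

lemma leibnizDefect_cocycle (a b c : A) :
    π a * leibnizDefect π D b c - leibnizDefect π D (a * b) c + leibnizDefect π D a (b * c)
      - leibnizDefect π D a b * π c = 0 := by
  simp only [leibnizDefect, map_mul, mul_sub, sub_mul, mul_assoc]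
  abel

/-- If additive maps satisfy `f a * A * g a = 0`, then `f a * A * g c = 0`. -/
lemma mul_mul_eq_zero_of_diag {f : A → B} {g : A → A}
    (hf : ∀ a c, f (a + c) = f a + f c) (hg : ∀ a c, g (a + c) = g a + g c)
    (h : ∀ a x, f a * π x * π (g a) = 0) (a c x : A) : f a * π x * π (g c) = 0 := by
  have hlin : ∀ x, f a * π x * π (g c) = -(f c * π x * π (g a)) := fun x ↦ by
    have h' := h (a + c) x
    simp only [hf, hg, map_add, add_mul, mul_add, h, zero_add, add_zero] at h'
    exact eq_neg_of_add_eq_zero_right h'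
  apply mul_eq_zero_of_mul_star_mul_self_right
  calc f a * π x * (π (g c) * star (π (g c)) * π (g c))
      = f a * π x * π (g c) * (star (π (g c)) * π (g c)) := by simp only [mul_assoc]
    _ = -(f c * π (x * g a * star (g c)) * π (g c)) := by
      rw [hlin]; simp only [map_mul, map_star, mul_assoc, neg_mul]
    _ = 0 := by rw [h, neg_zero]

/-- If additive maps satisfy `g a * A * f a = 0`, then `g c * A * f a = 0`. -/
lemma mul_mul_eq_zero_of_diag' {f : A → B} {g : A → A}
    (hf : ∀ a c, f (a + c) = f a + f c) (hg : ∀ a c, g (a + c) = g a + g c)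
    (h : ∀ a x, π (g a) * π x * f a = 0) (a c x : A) : π (g c) * π x * f a = 0 := by
  have hlin : ∀ x, π (g c) * π x * f a = -(π (g a) * π x * f c) := fun x ↦ by
    have h' := h (a + c) x
    simp only [hf, hg, map_add, add_mul, mul_add, h, zero_add, add_zero] at h'
    exact eq_neg_of_add_eq_zero_left h'
  rw [mul_assoc]
  apply mul_eq_zero_of_mul_star_mul_self_left
  calc π (g c) * star (π (g c)) * π (g c) * (π x * f a)
      = π (g c) * star (π (g c)) * (π (g c) * π x * f a) := by simp only [mul_assoc]
    _ = -(π (g c) * π (star (g c) * g a * x) * f c) := by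
      rw [hlin]; simp only [map_mul, map_star, mul_assoc, mul_neg]
    _ = 0 := by rw [h, neg_zero]

/-- If `z * x * k + k * x * z = 0` for all `x ∈ A`, both summands vanish. -/
lemma mul_mul_eq_zero_of_add_eq_zero {z : B} {k : A}
    (h : ∀ x, z * π x * π k + π k * π x * z = 0) (x : A) :
    z * π x * π k = 0 ∧ π k * π x * z = 0 := by
  have key : ∀ x, π k * π x * z = 0 := fun y ↦ by
    rw [mul_assoc]
    apply mul_eq_zero_of_mul_star_mul_self_left
    have h1 := h (star k * k * y)
    have h2 : z * π (star k) * π k = -(π k * π (star k) * z) := eq_neg_of_add_eq_zero_left (h _)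
    have h3 : z * π y * π k = -(π k * π y * z) := eq_neg_of_add_eq_zero_left (h _)
    have h4 : z * π (star k * k * y) * π k = π k * π (star k * k * y) * z := by
      calc z * π (star k * k * y) * π k
          = z * π (star k) * π k * (π y * π k) := by simp only [map_mul, mul_assoc]
        _ = -(π k * π (star k) * (z * π y * π k)) := by rw [h2]; simp only [neg_mul, mul_assoc]
        _ = π k * π (star k * k * y) * z := by
          rw [h3]; simp only [map_mul, mul_assoc, mul_neg, neg_neg]
    rw [h4, ← two_smul ℂ, smul_eq_zero_iff_right two_ne_zero] at h1
    simpa only [map_mul, map_star, mul_assoc] using h1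
  exact ⟨by simpa only [key, add_zero] using h x, key x⟩

namespace IsJordanDerivation

lemma map_mul_add_mul (hD : IsJordanDerivation π D) (a b : A) :
    D (a * b + b * a) = D a * π b + π a * D b + D b * π a + π b * D a := by
  have h := hD (a + b)
  simp only [add_mul, mul_add, map_add, hD a, hD b] at h
  rw [map_add]
  linear_combination (norm := abel) h

lemma leibnizDefect_swap (hD : IsJordanDerivation π D) (a b : A) :
    leibnizDefect π D a b = -leibnizDefect π D b a := by
  have h := hD.map_mul_add_mul a b
  rw [map_add] at h
  simp only [leibnizDefect]
  linear_combination (norm := abel) h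

lemma leibnizDefect_self (hD : IsJordanDerivation π D) (a : A) : leibnizDefect π D a a = 0 := by
  simp only [leibnizDefect, hD a]
  abel

lemma map_mul_mul_self (hD : IsJordanDerivation π D) (a b : A) :
    D (a * b * a) = D a * π b * π a + π a * D b * π a + π a * π b * D a := by
  have h1 := hD.map_mul_add_mul a (a * b + b * a)
  have h2 := hD.map_mul_add_mul (a * a) b
  have h3 : a * (a * b + b * a) + (a * b + b * a) * a
      = (a * a * b + b * (a * a)) + (2 : ℂ) • (a * b * a) := by
    rw [two_smul]; noncomm_ring
  rw [h3, map_add, h2, hD a, hD.map_mul_add_mul a b, map_smul] at h1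
  apply smul_right_injective B (two_ne_zero (α := ℂ))
  simp only [map_add, map_mul, two_smul] at h1 ⊢
  linear_combination (norm := noncomm_ring) h1

lemma map_triple (hD : IsJordanDerivation π D) (a b c : A) :
    D (a * b * c + c * b * a) = D a * π b * π c + π a * D b * π c + π a * π b * D c
      + D c * π b * π a + π c * D b * π a + π c * π b * D a := by
  have h := hD.map_mul_mul_self (a + c) b
  have h1 := hD.map_mul_mul_self a b
  have h2 := hD.map_mul_mul_self c b
  simp only [add_mul, mul_add, map_add] at h ⊢
  linear_combination (norm := noncomm_ring) h - h1 - h2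

lemma leibnizDefect_mul_commutator (hD : IsJordanDerivation π D) (a b x : A) :
    leibnizDefect π D a b * π x * π (a * b - b * a)
      + π (a * b - b * a) * π x * leibnizDefect π D a b = 0 := by
  have h1 := hD.map_triple (a * b) x (b * a)
  have h2 := hD.map_mul_mul_self a (b * x * b)
  have h3 := hD.map_mul_mul_self b (a * x * a)
  rw [hD.map_mul_mul_self b x] at h2
  rw [hD.map_mul_mul_self a x] at h3
  have h4 : a * b * x * (b * a) + b * a * x * (a * b)
      = a * (b * x * b) * a + b * (a * x * a) * b := by noncomm_ring
  have h5 := hD.map_mul_add_mul a b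
  rw [h4, map_add, h2, h3] at h1
  have h6 : D (b * a) = D a * π b + π a * D b + D b * π a + π b * D a - D (a * b) := by
    rw [← h5, map_add]; abel
  rw [h6] at h1
  simp only [leibnizDefect, map_mul, map_sub] at h1 ⊢
  linear_combination (norm := noncomm_ring) h1

lemma annihilatesDefect_commutator (hD : IsJordanDerivation π D) (c d : A) :
    AnnihilatesDefect π D (c * d - d * c) := by
  have hdiag := fun a b ↦ mul_mul_eq_zero_of_add_eq_zero (hD.leibnizDefect_mul_commutator a b)
  have hl : ∀ a b c : A, (a + c) * b - b * (a + c) = (a * b - b * a) + (c * b - b * c) :=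
    fun a b c ↦ by noncomm_ring
  have hr : ∀ a b c : A, a * (b + c) - (b + c) * a = (a * b - b * a) + (a * c - c * a) :=
    fun a b c ↦ by noncomm_ring
  refine fun a b x ↦ ⟨?_, ?_⟩
  · have h1 : ∀ b x, leibnizDefect π D a b * π x * π (c * b - b * c) = 0 := fun b x ↦
      mul_mul_eq_zero_of_diag (f := fun a ↦ leibnizDefect π D a b) (g := fun a ↦ a * b - b * a)
        (fun _ _ ↦ leibnizDefect_add_left _ _ _) (fun _ _ ↦ hl _ _ _)
        (fun a x ↦ (hdiag a b x).1) a c x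
    exact mul_mul_eq_zero_of_diag (f := fun b ↦ leibnizDefect π D a b)
        (g := fun b ↦ c * b - b * c)
        (fun _ _ ↦ leibnizDefect_add_right _ _ _) (fun _ _ ↦ hr _ _ _) h1 b d x
  · have h1 : ∀ b x, π (c * b - b * c) * π x * leibnizDefect π D a b = 0 := fun b x ↦
      mul_mul_eq_zero_of_diag' (f := fun a ↦ leibnizDefect π D a b) (g := fun a ↦ a * b - b * a)
        (fun _ _ ↦ leibnizDefect_add_left _ _ _) (fun _ _ ↦ hl _ _ _)
        (fun a x ↦ (hdiag a b x).2) a c x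
    exact mul_mul_eq_zero_of_diag' (f := fun b ↦ leibnizDefect π D a b)
        (g := fun b ↦ c * b - b * c)
        (fun _ _ ↦ leibnizDefect_add_right _ _ _) (fun _ _ ↦ hr _ _ _) h1 b d x

end IsJordanDerivation

namespace AnnihilatesDefect

variable {k l : A}

lemma add (hk : AnnihilatesDefect π D k) (hl : AnnihilatesDefect π D l) :
    AnnihilatesDefect π D (k + l) := fun a b x ↦ by
  simp only [map_add, mul_add, add_mul, (hk a b x).1, (hk a b x).2, (hl a b x).1, (hl a b x).2,
    add_zero, and_self]

lemma smul (hk : AnnihilatesDefect π D k) (t : ℂ) : AnnihilatesDefect π D (t • k) :=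
  fun a b x ↦ by
  simp only [map_smul, mul_smul_comm, smul_mul_assoc, (hk a b x).1, (hk a b x).2, smul_zero,
    and_self]

lemma mul_left (hk : AnnihilatesDefect π D k) (y : A) : AnnihilatesDefect π D (y * k) :=
  fun a b x ↦ by
  have h1 := (hk a b (x * y)).1
  have h2 := (hk a b x).2
  simp only [map_mul, mul_assoc] at h1 h2 ⊢
  exact ⟨h1, by rw [h2, mul_zero]⟩

lemma mul_right (hk : AnnihilatesDefect π D k) (y : A) : AnnihilatesDefect π D (k * y) :=
  fun a b x ↦ by
  have h1 := (hk a b x).1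
  have h2 := (hk a b (y * x)).2
  refine ⟨?_, by simpa only [map_mul, mul_assoc] using h2⟩
  rw [map_mul, ← mul_assoc, h1, zero_mul]

/-- Cancellation `k k* k ↦ k` in the annihilator. -/
lemma of_mul_star_mul_self (hk : AnnihilatesDefect π D (k * star k * k)) :
    AnnihilatesDefect π D k := fun a b x ↦ by
  have h := hk a b x
  simp only [map_mul, map_star] at h
  refine ⟨mul_eq_zero_of_mul_star_mul_self_right h.1, ?_⟩
  rw [mul_assoc]
  apply mul_eq_zero_of_mul_star_mul_self_left
  rw [← mul_assoc, h.2]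

lemma star (hk : AnnihilatesDefect π D k) : AnnihilatesDefect π D (star k) := by
  apply of_mul_star_mul_self
  rw [star_star]
  exact (hk.mul_left _).mul_right _

lemma realPart (hk : AnnihilatesDefect π D k) : AnnihilatesDefect π D (ℜ k : A) := by
  rw [realPart_apply_coe, ← Complex.coe_smul]
  exact (hk.add hk.star).smul _

lemma imaginaryPart (hk : AnnihilatesDefect π D k) : AnnihilatesDefect π D (ℑ k : A) := by
  rw [imaginaryPart_apply_coe, ← Complex.coe_smul, sub_eq_add_neg, ← neg_one_smul ℂ (Star.star k)]
  exact ((hk.add (hk.star.smul _)).smul _).smul _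

lemma mul_map_mul_eq_zero_of_isSelfAdjoint (hD : IsJordanDerivation π D)
    (hk : AnnihilatesDefect π D k) (hsa : IsSelfAdjoint k) {r s : B}
    (hr : ∀ j, AnnihilatesDefect π D j → r * π j = 0)
    (hs : ∀ j, AnnihilatesDefect π D j → π j * s = 0) : r * D k * s = 0 := by
  obtain ⟨h, hh, rfl⟩ := hsa.exists_cube_root
  have hj : AnnihilatesDefect π D h := by
    apply of_mul_star_mul_self
    rwa [hh.star_eq]
  have hrh := hr h hj
  have hsh := hs h hj
  rw [hD.map_mul_mul_self]
  simp only [mul_add, add_mul, mul_assoc, hsh, mul_zero, zero_add, add_zero]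
  rw [← mul_assoc, hrh, zero_mul]

/-- `D k` lies in the sum of the left and right ideals generated by the annihilator. -/
lemma mul_map_mul_eq_zero (hD : IsJordanDerivation π D)
    (hk : AnnihilatesDefect π D k) {r s : B}
    (hr : ∀ j, AnnihilatesDefect π D j → r * π j = 0)
    (hs : ∀ j, AnnihilatesDefect π D j → π j * s = 0) : r * D k * s = 0 := by
  rw [← realPart_add_I_smul_imaginaryPart k, map_add, map_smul, mul_add, add_mul, mul_smul_comm,
    smul_mul_assoc, hk.realPart.mul_map_mul_eq_zero_of_isSelfAdjoint hD (ℜ k).2 hr hs,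
    hk.imaginaryPart.mul_map_mul_eq_zero_of_isSelfAdjoint hD (ℑ k).2 hr hs, smul_zero, add_zero]

lemma leibnizDefect_eq_zero (hD : IsJordanDerivation π D) (hk : AnnihilatesDefect π D k) (x : A) :
    leibnizDefect π D x k = 0 := by
  set r := leibnizDefect π D x k with hr
  have hl : ∀ j, AnnihilatesDefect π D j → Star.star r * π j = 0 := fun j hj ↦ by
    have h := (hj.star x k 1).2
    rw [← star_eq_zero]
    simpa only [map_one, mul_one, star_mul, star_star, map_star] using h
  have hs : ∀ j, AnnihilatesDefect π D j → π j * Star.star r = 0 := fun j hj ↦ by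
    have h := (hj.star x k 1).1
    rw [← star_eq_zero]
    simpa only [map_one, mul_one, star_mul, star_star, map_star] using h
  have h1 := (hk.mul_left x).mul_map_mul_eq_zero hD hl hs
  have h2 : Star.star r * π x * D k * Star.star r = 0 :=
    hk.mul_map_mul_eq_zero hD (fun j hj ↦ by
      rw [mul_assoc, ← map_mul]; exact hl _ (hj.mul_left x)) hs
  have h3 : Star.star r * r * Star.star r = 0 := by
    nth_rewrite 2 [hr]
    simp only [leibnizDefect, mul_sub, sub_mul, h1]
    rw [← mul_assoc _ (π x), h2, ← mul_assoc, mul_assoc _ (π k), hs k hk, mul_zero, sub_zero,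
      sub_zero]
  have h4 := mul_eq_zero_of_mul_star_mul_self_left (k := r) (m := 1)
    (by rw [← star_eq_zero]; simpa only [mul_one, star_mul, star_star, mul_assoc] using h3)
  rwa [mul_one] at h4

end AnnihilatesDefect

namespace IsJordanDerivation

lemma leibnizDefect_mul_self_left (hD : IsJordanDerivation π D) (x c : A) :
    leibnizDefect π D (x * x) c = (2 : ℂ) • (π x * leibnizDefect π D x c) := by
  have hcomm : leibnizDefect π D x (x * c) = leibnizDefect π D x (c * x) := by
    have h := (hD.annihilatesDefect_commutator x c).leibnizDefect_eq_zero hD x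
    rw [← sub_add_cancel (x * c) (c * x), leibnizDefect_add_right, h, zero_add]
  have h1 := leibnizDefect_cocycle (π := π) (D := D) x x c
  have h2 := leibnizDefect_cocycle (π := π) (D := D) c x x
  have h3 := leibnizDefect_cocycle (π := π) (D := D) x c x
  rw [hD.leibnizDefect_self, zero_mul, sub_zero, hcomm] at h1
  rw [hD.leibnizDefect_self, mul_zero, hD.leibnizDefect_swap (c * x),
    hD.leibnizDefect_swap c (x * x), hD.leibnizDefect_swap c x] at h2
  rw [hD.leibnizDefect_swap (x * c), hcomm, hD.leibnizDefect_swap c x] at h3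
  apply smul_right_injective B (two_ne_zero (α := ℂ))
  simp only [two_smul]
  linear_combination (norm := noncomm_ring) (-3 : ℤ) • h1 + h2 + h3

lemma leibnizDefect_pow_left (hD : IsJordanDerivation π D) (x c : A) (n : ℕ) :
    π x * leibnizDefect π D (x ^ 2 ^ n) c
      = (2 ^ n : ℂ) • (π (x ^ 2 ^ n) * leibnizDefect π D x c) := by
  induction n with
  | zero => simp
  | succ n ih =>
    have hx : π x * π (x ^ 2 ^ n) = π (x ^ 2 ^ n) * π x := by
      rw [← map_mul, ← map_mul, (Commute.self_pow x _).eq]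
    rw [pow_succ 2 n, mul_two, pow_add, hD.leibnizDefect_mul_self_left, mul_smul_comm,
      ← mul_assoc, hx, mul_assoc, ih, mul_smul_comm, smul_smul, ← mul_assoc, map_mul,
      pow_succ, mul_comm]

lemma leibnizDefect_eq_zero_of_mem_unitary (hD : IsJordanDerivation π D) (hcont : Continuous D)
    {u : A} (hu : u ∈ unitary A) (c : A) : leibnizDefect π D u c = 0 := by
  obtain ⟨C, hC⟩ : ∃ C : ℝ, ∀ v ∈ unitary A, ‖leibnizDefect π D v c‖ ≤ C := by
    let T : A →L[ℂ] B := ⟨D, hcont⟩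
    refine ⟨‖T‖ * ‖c‖ + ‖T‖ * ‖(1 : A)‖ * ‖π c‖ + ‖D c‖, fun v hv ↦ ?_⟩
    have h1 : ‖D (v * c)‖ ≤ ‖T‖ * ‖c‖ := by
      rw [← CStarRing.norm_mem_unitary_mul c hv]
      exact T.le_opNorm _
    have h2 : ‖D v * π c‖ ≤ ‖T‖ * ‖(1 : A)‖ * ‖π c‖ := by
      refine (norm_mul_le _ _).trans (mul_le_mul_of_nonneg_right ?_ (norm_nonneg _))
      rw [← CStarRing.norm_mem_unitary_mul 1 hv, mul_one]
      exact T.le_opNorm _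
    have h3 : ‖π v * D c‖ = ‖D c‖ :=
      CStarRing.norm_mem_unitary_mul _ (Unitary.map_mem π hv)
    calc ‖leibnizDefect π D v c‖ ≤ ‖D (v * c)‖ + ‖D v * π c‖ + ‖π v * D c‖ :=
          (norm_sub_le _ _).trans (add_le_add_left (norm_sub_le _ _) _)
      _ ≤ _ := by rw [h3]; gcongr
  have hbound : ∀ n : ℕ, 2 ^ n * ‖leibnizDefect π D u c‖ ≤ C := fun n ↦ by
    have hn : u ^ 2 ^ n ∈ unitary A := pow_mem hu _
    have h := congrArg norm (hD.leibnizDefect_pow_left u c n)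
    rw [CStarRing.norm_mem_unitary_mul _ (Unitary.map_mem π hu), norm_smul,
      CStarRing.norm_mem_unitary_mul _ (Unitary.map_mem π hn), norm_pow, RCLike.norm_ofNat] at h
    exact h ▸ hC _ hn
  by_contra hne
  have hpos : 0 < ‖leibnizDefect π D u c‖ := norm_pos_iff.2 hne
  obtain ⟨n, hn⟩ := pow_unbounded_of_one_lt (C / ‖leibnizDefect π D u c‖) one_lt_two
  rw [div_lt_iff₀ hpos] at hn
  exact (hbound n).not_gt hn

/-- A continuous Jordan derivation between C⋆-algebras is a derivation. -/
theorem map_mul (hD : IsJordanDerivation π D) (hcont : Continuous D) (a b : A) :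
    D (a * b) = D a * π b + π a * D b := by
  have h : leibnizDefect π D a b = 0 := by
    have ha : a ∈ Submodule.span ℂ (unitary A : Set A) := by
      rw [CStarAlgebra.span_unitary]; trivial
    induction ha using Submodule.span_induction with
    | mem u hu => exact hD.leibnizDefect_eq_zero_of_mem_unitary hcont hu b
    | zero => simp [leibnizDefect]
    | add x y _ _ hx hy => rw [leibnizDefect_add_left, hx, hy, add_zero]
    | smul t x _ hx => rw [leibnizDefect_smul_left, hx, smul_zero]
  rw [leibnizDefect, sub_sub, sub_eq_zero] at h
  exact h

end IsJordanDerivation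

end JordanDerivation

section TripleDerivationAtOne

open scoped CStarAlgebra

variable {A B : Type*} [CStarAlgebra A] [CStarAlgebra B] {π : A →⋆ₐ[ℂ] B} {T : A →ₗ[ℂ] B}

lemma two_smul_trip {R : Type*} [NonUnitalRing R] [Module ℂ R] [Star R] (a b c : R) :
    (2 : ℂ) • trip a b c = a * star b * c + c * star b * a := by
  rw [trip, smul_inv_smul₀ two_ne_zero]

/-- The defining identity of a triple derivation at the unit, cleared of denominators. -/
lemma two_smul_map_one_of_triple (hT : ∀ a b c : A, trip (π a) (π b) (π c) = 1 →
      T 1 = trip (T a) (π b) (π c) + trip (π a) (T b) (π c) + trip (π a) (π b) (T c))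
    {a b c : A} (h : a * b * c + c * b * a = (2 : ℂ) • 1) :
    (2 : ℂ) • T 1 = (T a * π b * π c + π c * π b * T a)
      + (π a * star (T (star b)) * π c + π c * star (T (star b)) * π a)
      + (π a * π b * T c + T c * π b * π a) := by
  have h' := hT a (star b) c (by
    rw [trip, map_star, star_star]
    simp only [← map_mul, ← map_add, h, map_smul, map_one]
    rw [inv_smul_smul₀ two_ne_zero])
  rw [h']
  simp only [smul_add, two_smul_trip, map_star, star_star]

lemma star_map_one_of_triple (hT : ∀ a b c : A, trip (π a) (π b) (π c) = 1 →
      T 1 = trip (T a) (π b) (π c) + trip (π a) (T b) (π c) + trip (π a) (π b) (T c)) :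
    star (T 1) = -T 1 := by
  have h := two_smul_map_one_of_triple hT (a := 1) (b := 1) (c := 1)
    (by rw [two_smul]; simp only [one_mul])
  simp only [map_one, mul_one, one_mul, star_one] at h
  apply smul_right_injective B (two_ne_zero (α := ℂ))
  simp only [two_smul] at h ⊢
  linear_combination (norm := abel) -h

/-- The quadratic identity satisfied by `x ↦ (T x*)*`, at the invertible elements. -/
lemma star_map_star_mul_self_of_isUnit (hT : ∀ a b c : A, trip (π a) (π b) (π c) = 1 →
      T 1 = trip (T a) (π b) (π c) + trip (π a) (T b) (π c) + trip (π a) (π b) (T c))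
    {b : A} (hb : IsUnit b) :
    star (T (star (b * b))) = star (T (star b)) * π b + π b * star (T (star b))
      + π b * T 1 * π b := by
  obtain ⟨u, rfl⟩ := hb
  set a : A := ↑u⁻¹ with ha
  set b : A := ↑u with hb
  have hab : a * b = 1 := u.inv_mul
  have hba : b * a = 1 := u.mul_inv
  have hπab : π a * π b = 1 := by rw [← map_mul, hab, map_one]
  have hπba : π b * π a = 1 := by rw [← map_mul, hba, map_one]
  have hl : ∀ z, π b * (π a * z) = z := fun z ↦ by rw [← mul_assoc, hπba, one_mul]
  have hl' : ∀ z, π a * (π b * z) = z := fun z ↦ by rw [← mul_assoc, hπab, one_mul]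
  have h1 := two_smul_map_one_of_triple hT (a := a) (b := b) (c := 1)
    (by rw [two_smul, mul_one, one_mul, hab, hba])
  have h2 := two_smul_map_one_of_triple hT (a := a) (b := b * b) (c := a)
    (by rw [two_smul, ← mul_assoc, hab, one_mul, hba])
  replace h1 := congrArg (fun z ↦ π b * z * π b) h1
  replace h2 := congrArg (fun z ↦ π b * z * π b) h2
  apply smul_right_injective B (two_ne_zero (α := ℂ))
  simp only [two_smul, mul_add, add_mul, map_mul, map_one, mul_assoc, one_mul, mul_one, hl, hl',
    hπab, hπba] at h1 h2 ⊢
  linear_combination (norm := noncomm_ring) -h2 + (2 : ℤ) • h1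

/-- The quadratic identity satisfied by `x ↦ (T x*)*`. -/
lemma star_map_star_mul_self (hT : ∀ a b c : A, trip (π a) (π b) (π c) = 1 →
      T 1 = trip (T a) (π b) (π c) + trip (π a) (T b) (π c) + trip (π a) (π b) (T c))
    (x : A) :
    star (T (star (x * x))) = star (T (star x)) * π x + π x * star (T (star x))
      + π x * T 1 * π x := by
  obtain ⟨t, ht⟩ : ∃ t : ℝ, IsUnit (x + (t : ℂ) • (1 : A)) := by
    refine ⟨‖-x‖ * ‖(1 : A)‖ + 1, ?_⟩
    have h : ((‖-x‖ * ‖(1 : A)‖ + 1 : ℝ) : ℂ) ∈ resolventSet ℂ (-x) := by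
      apply spectrum.mem_resolventSet_of_norm_lt_mul
      rw [Complex.norm_real, Real.norm_of_nonneg (by positivity)]
      exact lt_add_one _
    rwa [spectrum.mem_resolventSet_iff, Algebra.algebraMap_eq_smul_one, sub_neg_eq_add,
      add_comm] at h
  have h := star_map_star_mul_self_of_isUnit hT ht
  have h1 := star_map_one_of_triple hT
  simp only [add_mul, mul_add, smul_mul_assoc, mul_smul_comm, one_mul, mul_one, star_add, map_add,
    star_smul, map_smul, star_one, h1, map_one, Complex.star_def, Complex.conj_ofReal, smul_add,
    smul_neg, neg_mul, mul_neg] at h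
  linear_combination (norm := module) h

lemma isJordanDerivation_of_triple (hT : ∀ a b c : A, trip (π a) (π b) (π c) = 1 →
      T 1 = trip (T a) (π b) (π c) + trip (π a) (T b) (π c) + trip (π a) (π b) (T c)) :
    IsJordanDerivation π (T - LinearMap.mulLeft ℂ (T 1) ∘ₗ π.toAlgHom.toLinearMap) := fun x ↦ by
  have h := congrArg star (star_map_star_mul_self hT (star x))
  simp only [star_add, star_mul, star_star, map_star, star_map_one_of_triple hT] at h
  simp [h]
  noncomm_ring

/-- A continuous triple derivation at the unit is a generalized derivation. -/
theorem map_mul_of_triple (hcont : Continuous T)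
    (hT : ∀ a b c : A, trip (π a) (π b) (π c) = 1 →
      T 1 = trip (T a) (π b) (π c) + trip (π a) (T b) (π c) + trip (π a) (π b) (T c))
    (x y : A) : T (x * y) = T x * π y + π x * T y - π x * T 1 * π y := by
  have hπ : Continuous π := map_continuous π
  have h := (isJordanDerivation_of_triple hT).map_mul
    (hcont.sub (continuous_const.mul hπ)) x y
  simp at h
  linear_combination (norm := noncomm_ring) h

end TripleDerivationAtOne

/-- A continuous linear map `T : A → B` on a C*-subalgebra `A` (containing the unit) of a unital
C*-algebra `B` which is a triple derivation at the unit is a generalized derivation. -/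
theorem stmt2 {B : Type*} [CStarAlgebra B] (A : StarSubalgebra ℂ B)
    (hA : IsClosed (A : Set B)) (T : A →ₗ[ℂ] B) (hcont : Continuous T)
    (hT : ∀ a b c : A, trip (a : B) (b : B) (c : B) = 1 →
      T 1 = trip (T a) (b : B) (c : B) + trip (a : B) (T b) (c : B)
        + trip (a : B) (b : B) (T c)) :
    ∀ x y : A, T (x * y) = T x * (y : B) + (x : B) * T y - (x : B) * T 1 * (y : B) := by
  have : IsClosed (A : Set B) := hA
  exact map_mul_of_triple (π := A.subtype) hcont hT
end

section
/- Let A be a unital C*-algebra and let T : A → A be a continuous linear map which is a triple derivation at the unit 1. Then T is a triple derivation, that is, T({a,b,c}) = {T(a),b,c} + {a,T(b),c} + {a,b,T(c)} for all a, b, c ∈ A. -/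
open Filter Topology

/-- A linear map satisfying `S (x²) = S x * x + x * S x` is a Jordan derivation. -/
theorem map_jordan_of_map_sq {A : Type*} [Ring A] [Algebra ℂ A] {S : A →ₗ[ℂ] A}
    (hS : ∀ x, S (x * x) = S x * x + x * S x) (x y : A) :
    S (x * y + y * x) = S x * y + y * S x + (x * S y + S y * x) := by
  have h := hS (x + y)
  simp only [add_mul, mul_add, map_add, hS x, hS y] at h ⊢
  linear_combination (norm := abel) h

section Ring

variable {A : Type*} [Ring A] [StarRing A] [Algebra ℂ A]

/-- Left multiplication by a skew-adjoint element is a triple derivation. -/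
theorem trip_mul_left_of_star_eq_neg {h : A} (hh : star h = -h) (a b c : A) :
    trip (h * a) b c + trip a (h * b) c + trip a b (h * c) = h * trip a b c := by
  simp only [trip, star_mul, hh, ← smul_add, mul_smul_comm]
  congr 1
  noncomm_ring

/-- A Jordan derivation commuting with the involution is a triple derivation. -/
theorem map_trip_of_jordan {S : A →ₗ[ℂ] A}
    (hS : ∀ x y, S (x * y + y * x) = S x * y + y * S x + (x * S y + S y * x))
    (hstar : ∀ x, S (star x) = star (S x)) (a b c : A) :
    S (trip a b c) = trip (S a) b c + trip a (S b) c + trip a b (S c) := by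
  have key : trip a b c = (4 : ℂ)⁻¹ •
      (((a * star b + star b * a) * c + c * (a * star b + star b * a))
        + ((c * star b + star b * c) * a + a * (c * star b + star b * c))
        - ((a * c + c * a) * star b + star b * (a * c + c * a))) := by
    simp only [trip, mul_add, add_mul, mul_assoc]
    module
  rw [key, map_smul, map_sub, map_add, hS _ c, hS _ a, hS a (star b),
    hS c (star b), hS _ (star b), hS a c, hstar]
  simp only [trip, mul_add, add_mul, mul_assoc]
  module

end Ring

section CStar

variable {A : Type*} [CStarAlgebra A]

/-- The second-order remainder `x² (1 - t x)⁻¹` of the Neumann series tends to `x²`. -/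
theorem tendsto_sq_mul_inverse_one_sub (x : A) :
    Tendsto (fun t : ℂ => x * x * Ring.inverse (1 - t • x)) (𝓝[≠] 0) (𝓝 (x * x)) := by
  have h : ContinuousAt (fun t : ℂ => x * x * Ring.inverse (1 - t • x)) 0 := by
    refine continuousAt_const.mul (ContinuousAt.comp (g := Ring.inverse) ?_ (by fun_prop))
    simpa using NormedRing.inverse_continuousAt (1 : Aˣ)
  simpa using h.tendsto.mono_left nhdsWithin_le_nhds

theorem eventually_isUnit_one_sub_smul (x : A) :
    ∀ᶠ t : ℂ in 𝓝[≠] 0, IsUnit (1 - t • x) := by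
  have h : ContinuousAt (fun t : ℂ => 1 - t • x) 0 := by fun_prop
  refine nhdsWithin_le_nhds (h.eventually_mem (s := {y | IsUnit y}) ?_)
  simpa using Units.nhds (1 : Aˣ)

theorem inverse_one_sub_smul {x : A} {t : ℂ} (h : IsUnit (1 - t • x)) :
    Ring.inverse (1 - t • x) = 1 + t • x + t ^ 2 • (x * x * Ring.inverse (1 - t • x)) := by
  have h₁ := Ring.mul_inverse_cancel _ h
  have h₂ := congrArg (fun y => x * y) h₁
  simp only [sub_mul, mul_sub, one_mul, mul_one, smul_mul_assoc, mul_smul_comm,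
    ← mul_assoc] at h₁ h₂
  linear_combination (norm := module) h₁ + t • h₂

/-- A linear map vanishing at `1` which is a triple derivation at `1` satisfies the Jordan
derivation identity for squares. -/
theorem map_sq_of_trip_at_one {S : A →ₗ[ℂ] A} (hcont : Continuous S) (h1 : S 1 = 0)
    (hS : ∀ a b c : A, trip a b c = 1 → trip (S a) b c + trip a (S b) c + trip a b (S c) = 0)
    (x : A) : S (x * x) = S x * x + x * S x := by
  have hw := tendsto_sq_mul_inverse_one_sub x
  set w : ℂ → A := fun t => x * x * Ring.inverse (1 - t • x)
  let F : ℂ × A → A := fun p => S p.2 - (S x * x + x * S x)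
    - ((2 : ℂ)⁻¹ * p.1) • (S x * p.2 + p.2 * S x + x * S p.2 + S p.2 * x)
  have hF : Continuous F := by fun_prop
  have hlim : Tendsto (fun t => F (t, w t)) (𝓝[≠] 0) (𝓝 (F (0, x * x))) :=
    (hF.tendsto _).comp ((tendsto_id.mono_left nhdsWithin_le_nhds).prodMk_nhds hw)
  have hzero : ∀ᶠ t in 𝓝[≠] (0 : ℂ), F (t, w t) = 0 := by
    filter_upwards [eventually_isUnit_one_sub_smul x, self_mem_nhdsWithin] with t hu ht
    have ht : t ≠ 0 := ht
    have hz := inverse_one_sub_smul hu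
    have h := hS (1 - t • x) 1 (Ring.inverse (1 - t • x)) (by
      simp only [trip, star_one, mul_one, Ring.mul_inverse_cancel _ hu,
        Ring.inverse_mul_cancel _ hu]
      module)
    change _ = 1 + t • x + t ^ 2 • w t at hz
    rw [hz] at h
    refine (smul_eq_zero_iff_right (pow_ne_zero 2 ht)).mp ?_
    simp only [trip, star_one, star_zero, mul_one, one_mul, mul_zero, zero_mul, h1, map_add,
      map_sub, map_smul, add_mul, mul_add, sub_mul, mul_sub, smul_mul_assoc, mul_smul_comm] at h
    simp only [F]
    linear_combination (norm := module) h
  have := tendsto_nhds_unique (hlim.congr' hzero) tendsto_const_nhds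
  simpa [F, sub_eq_zero] using this

/-- A linear map vanishing at `1` which is a triple derivation at `1` commutes with the
involution. -/
theorem map_star_of_trip_at_one {S : A →ₗ[ℂ] A} (hcont : Continuous S) (h1 : S 1 = 0)
    (hS : ∀ a b c : A, trip a b c = 1 → trip (S a) b c + trip a (S b) c + trip a b (S c) = 0)
    (x : A) : S (star x) = star (S x) := by
  have hw := tendsto_sq_mul_inverse_one_sub x
  set w : ℂ → A := fun t => x * x * Ring.inverse (1 - t • x)
  let F : ℂ × A → A := fun p => S x - star (S (star x))
    + p.1 • (S p.2 - (2 : ℂ)⁻¹ • (star (S (star x)) * (x + p.1 • p.2)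
      + (x + p.1 • p.2) * star (S (star x)) + x * (S x + p.1 • S p.2)
      + (S x + p.1 • S p.2) * x))
  have hF : Continuous F := by fun_prop
  have hlim : Tendsto (fun t => F (t, w t)) (𝓝[≠] 0) (𝓝 (F (0, x * x))) :=
    (hF.tendsto _).comp ((tendsto_id.mono_left nhdsWithin_le_nhds).prodMk_nhds hw)
  have hzero : ∀ᶠ t in 𝓝[≠] (0 : ℂ), F (t, w t) = 0 := by
    filter_upwards [eventually_isUnit_one_sub_smul x, self_mem_nhdsWithin] with t hu ht
    have ht : t ≠ 0 := ht
    have hz := inverse_one_sub_smul hu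
    have h := hS 1 (1 - star t • star x) (Ring.inverse (1 - t • x)) (by
      simp only [trip, star_sub, star_smul, star_star, star_one, mul_one, one_mul,
        Ring.mul_inverse_cancel _ hu, Ring.inverse_mul_cancel _ hu]
      module)
    change _ = 1 + t • x + t ^ 2 • w t at hz
    rw [hz] at h
    refine (smul_eq_zero_iff_right ht).mp ?_
    simp only [trip, star_sub, star_smul, star_star, star_one, star_zero, mul_one, one_mul,
      mul_zero, zero_mul, h1, map_add, map_sub, map_smul, add_mul, mul_add, sub_mul, mul_sub,
      smul_mul_assoc, mul_smul_comm] at h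
    simp only [F, add_mul, mul_add, smul_mul_assoc, mul_smul_comm]
    linear_combination (norm := module) h
  have := tendsto_nhds_unique (hlim.congr' hzero) tendsto_const_nhds
  have h : S x = star (S (star x)) := by simpa [F, sub_eq_zero] using this
  rw [h, star_star]

end CStar

/-- A continuous linear map `T` on a unital C*-algebra which is a triple derivation at the unit
is a triple derivation. -/
theorem stmt4 {A : Type*} [CStarAlgebra A] (T : A →ₗ[ℂ] A) (hcont : Continuous T)
    (hT : ∀ a b c : A, trip a b c = 1 →
      T 1 = trip (T a) b c + trip a (T b) c + trip a b (T c)) :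
    ∀ a b c : A, T (trip a b c) = trip (T a) b c + trip a (T b) c + trip a b (T c) := by
  have hskew : star (T 1) = -T 1 := by
    have h := hT 1 1 1 (by simp only [trip, star_one, mul_one]; module)
    simp only [trip, star_one, mul_one, one_mul] at h
    linear_combination (norm := module) -h
  let S : A →ₗ[ℂ] A := T - LinearMap.mulLeft ℂ (T 1)
  have hSdef : ∀ x, S x = T x - T 1 * x := fun x => rfl
  have hsplit : ∀ a b c : A, trip (S a) b c + trip a (S b) c + trip a b (S c)
      = trip (T a) b c + trip a (T b) c + trip a b (T c) - T 1 * trip a b c := by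
    intro a b c
    rw [← trip_mul_left_of_star_eq_neg hskew]
    simp only [hSdef, trip, star_sub, sub_mul, mul_sub]
    module
  have hSc : Continuous S := hcont.sub (continuous_const.mul continuous_id)
  have hS1 : S 1 = 0 := by simp [hSdef]
  have hS : ∀ a b c : A, trip a b c = 1 →
      trip (S a) b c + trip a (S b) c + trip a b (S c) = 0 := by
    intro a b c h
    rw [hsplit, ← hT a b c h, h, mul_one, sub_self]
  intro a b c
  have h := map_trip_of_jordan (map_jordan_of_map_sq (map_sq_of_trip_at_one hSc hS1 hS))
    (map_star_of_trip_at_one hSc hS1 hS) a b c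
  rw [hsplit, hSdef] at h
  exact sub_left_injective h
end

section
/- Let B be a unital C*-algebra, let A be a C*-subalgebra of B containing the unit 1 of B, and let T : A → B be a bounded linear map which is a triple derivation at zero. Then T is a generalized derivation, that is, T(xy) = T(x)y + xT(y) − xT(1)y for all x, y ∈ A. -/
open scoped ComplexStarModule CStarAlgebra

section SignAveraging

variable {E F G : Type*} [SeminormedAddCommGroup E] [NormedSpace ℝ E]
  [SeminormedAddCommGroup F] [NormedSpace ℝ F] [SeminormedAddCommGroup G] [NormedSpace ℝ G]

/-- The diagonal sum of a bilinear map is dominated by its value at suitably signed sums. -/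
lemma exists_signs_norm_sum_le {κ : Type*} [DecidableEq κ] (β : E →ₗ[ℝ] F →ₗ[ℝ] G)
    (s : Finset κ) (u : κ → E) (v : κ → F) (u₀ : E) (v₀ : F) :
    ∃ σ : κ → ℝ, (∀ i, |σ i| ≤ 1) ∧
      ‖β u₀ v₀ + ∑ i ∈ s, β (u i) (v i)‖ ≤
        ‖β (u₀ + ∑ i ∈ s, σ i • u i) (v₀ + ∑ i ∈ s, σ i • v i)‖ := by
  induction s using Finset.induction_on generalizing u₀ v₀ with
  | empty => exact ⟨fun _ => 1, by simp, by simp⟩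
  | insert j s hj ih =>
    set r := ∑ i ∈ s, β (u i) (v i) with hr
    have key : ∃ τ : ℝ, |τ| ≤ 1 ∧ ‖β u₀ v₀ + (β (u j) (v j) + r)‖ ≤
        ‖β (u₀ + τ • u j) (v₀ + τ • v j) + r‖ := by
      by_contra! h
      have h₁ := h 1 (by simp)
      have h₂ := h (-1) (by simp)
      have h₃ : β u₀ v₀ + (β (u j) (v j) + r) =
          (2⁻¹ : ℝ) • ((β (u₀ + (1 : ℝ) • u j) (v₀ + (1 : ℝ) • v j) + r) +
            (β (u₀ + (-1 : ℝ) • u j) (v₀ + (-1 : ℝ) • v j) + r)) := by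
        simp only [map_add, map_smul, LinearMap.add_apply, LinearMap.smul_apply]
        module
      have h₄ := norm_smul_le (2⁻¹ : ℝ)
        ((β (u₀ + (1 : ℝ) • u j) (v₀ + (1 : ℝ) • v j) + r) +
            (β (u₀ + (-1 : ℝ) • u j) (v₀ + (-1 : ℝ) • v j) + r))
      rw [← h₃] at h₄
      have h₅ := norm_add_le (β (u₀ + (1 : ℝ) • u j) (v₀ + (1 : ℝ) • v j) + r)
        (β (u₀ + (-1 : ℝ) • u j) (v₀ + (-1 : ℝ) • v j) + r)
      norm_num at h₄
      norm_num at h₁ h₂ h₅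
      linarith
    obtain ⟨τ, hτ, hle⟩ := key
    obtain ⟨σ, hσ, hle'⟩ := ih (u₀ + τ • u j) (v₀ + τ • v j)
    refine ⟨Function.update σ j τ, fun i => ?_, ?_⟩
    · by_cases hi : i = j
      · subst hi; simpa using hτ
      · simpa [hi] using hσ i
    · rw [Finset.sum_insert hj, Finset.sum_insert hj, Finset.sum_insert hj]
      have hu : ∑ i ∈ s, Function.update σ j τ i • u i = ∑ i ∈ s, σ i • u i :=
        Finset.sum_congr rfl fun i hi => by
          rw [Function.update_of_ne (ne_of_mem_of_not_mem hi hj)]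
      have hv : ∑ i ∈ s, Function.update σ j τ i • v i = ∑ i ∈ s, σ i • v i :=
        Finset.sum_congr rfl fun i hi => by
          rw [Function.update_of_ne (ne_of_mem_of_not_mem hi hj)]
      rw [hu, hv, Function.update_self, ← add_assoc u₀, ← add_assoc v₀]
      exact hle.trans hle'

lemma norm_sum_bilin_le {κ : Type*} (β : E →ₗ[ℝ] F →ₗ[ℝ] G) {C U V : ℝ} (hC : 0 ≤ C)
    (hβ : ∀ f g, ‖β f g‖ ≤ C * ‖f‖ * ‖g‖) (s : Finset κ) (u : κ → E) (v : κ → F)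
    (hU : ∀ σ : κ → ℝ, (∀ i, |σ i| ≤ 1) → ‖∑ i ∈ s, σ i • u i‖ ≤ U)
    (hV : ∀ σ : κ → ℝ, (∀ i, |σ i| ≤ 1) → ‖∑ i ∈ s, σ i • v i‖ ≤ V) :
    ‖∑ i ∈ s, β (u i) (v i)‖ ≤ C * U * V := by
  classical
  obtain ⟨σ, hσ, hle⟩ := exists_signs_norm_sum_le β s u v 0 0
  simp only [map_zero, zero_add] at hle
  have hU' := hU σ hσ
  have hV' := hV σ hσ
  have hU0 : 0 ≤ U := (norm_nonneg _).trans hU'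
  calc _ ≤ _ := hle
    _ ≤ _ := hβ _ _
    _ ≤ C * U * V := by gcongr

end SignAveraging

section Ramp

/-- The piecewise linear function equal to `0` on `(-∞, 0]` and to `1` on `[1, ∞)`. -/
noncomputable def ramp (t : ℝ) : ℝ := max 0 (min 1 t)

lemma continuous_ramp : Continuous ramp := by unfold ramp; fun_prop

lemma ramp_nonneg (t : ℝ) : 0 ≤ ramp t := le_max_left _ _

lemma ramp_le_one (t : ℝ) : ramp t ≤ 1 := by simp [ramp]

lemma ramp_of_nonpos {t : ℝ} (h : t ≤ 0) : ramp t = 0 := by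
  simp [ramp, h]

lemma ramp_of_one_le {t : ℝ} (h : 1 ≤ t) : ramp t = 1 := by
  simp [ramp, h]

lemma monotone_ramp : Monotone ramp := fun _ _ h => by unfold ramp; gcongr

lemma sum_ramp_sub (s : ℝ) (N : ℕ) :
    ∑ i ∈ Finset.range N, (ramp (s - i) - ramp (s - i - 1)) = ramp s - ramp (s - N) := by
  have := Finset.sum_range_sub' (fun i : ℕ => ramp (s - i)) N
  simp only [Nat.cast_add, Nat.cast_one, Nat.cast_zero, sub_zero] at this
  simpa only [sub_sub] using this

lemma sum_ramp_sub_wide_le (s : ℝ) (N : ℕ) :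
    ∑ i ∈ Finset.range N, (ramp (s - i + 2) - ramp (s - i - 3)) ≤ 5 := by
  have h (m : ℝ) : ∑ i ∈ Finset.range N, (ramp (s + m - i) - ramp (s + m - i - 1)) ≤ 1 := by
    rw [sum_ramp_sub]
    linarith [ramp_le_one (s + m), ramp_nonneg (s + m - N)]
  have key : ∑ i ∈ Finset.range N, (ramp (s - i + 2) - ramp (s - i - 3)) =
      ∑ i ∈ Finset.range N, (ramp (s + 2 - i) - ramp (s + 2 - i - 1)) +
      ∑ i ∈ Finset.range N, (ramp (s + 1 - i) - ramp (s + 1 - i - 1)) +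
      ∑ i ∈ Finset.range N, (ramp (s + 0 - i) - ramp (s + 0 - i - 1)) +
      ∑ i ∈ Finset.range N, (ramp (s + -1 - i) - ramp (s + -1 - i - 1)) +
      ∑ i ∈ Finset.range N, (ramp (s + -2 - i) - ramp (s + -2 - i - 1)) := by
    simp only [← Finset.sum_add_distrib]
    refine Finset.sum_congr rfl fun i _ => ?_
    ring_nf
  linarith [h 2, h 1, h 0, h (-1), h (-2)]

end Ramp

section ContinuousFunctions

variable {X G : Type*} [TopologicalSpace X] [CompactSpace X]

lemma norm_sum_smul_le_of_abs_le {κ : Type*} (s : Finset κ) (u w : κ → C(X, ℝ)) {K : ℝ}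
    (hK : 0 ≤ K) (huw : ∀ i ∈ s, ∀ t, |u i t| ≤ w i t) (hw : ∀ t, ∑ i ∈ s, w i t ≤ K)
    (σ : κ → ℝ) (hσ : ∀ i, |σ i| ≤ 1) : ‖∑ i ∈ s, σ i • u i‖ ≤ K := by
  refine (ContinuousMap.norm_le _ hK).2 fun t => ?_
  rw [ContinuousMap.sum_apply]
  refine (norm_sum_le _ _).trans ((Finset.sum_le_sum fun i hi => ?_).trans (hw t))
  rw [ContinuousMap.smul_apply, norm_smul, Real.norm_eq_abs, Real.norm_eq_abs]
  calc _ ≤ 1 * |u i t| := by gcongr; exact hσ i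
    _ ≤ w i t := by simpa using huw i hi t

variable [SeminormedAddCommGroup G] [NormedSpace ℝ G]

/-- The quantitative form of `bilin_continuousMap_comm`. -/
lemma norm_bilin_sub_le (β : C(X, ℝ) →ₗ[ℝ] C(X, ℝ) →ₗ[ℝ] G) {C : ℝ} (hC : 0 ≤ C)
    (hβ : ∀ f g, ‖β f g‖ ≤ C * ‖f‖ * ‖g‖)
    (hsep : ∀ f g k : C(X, ℝ), g * k = g → k * f = 0 → β f g = 0) (x : C(X, ℝ))
    {δ : ℝ} (hδ : 0 < δ) : ‖β x 1 - β 1 x‖ ≤ 30 * C * δ := by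
  obtain ⟨M, hM⟩ := exists_nat_gt (‖x‖ / δ)
  -- `s` is the rescaled function, with values in `[1, 2 M + 1]`.
  let s : C(X, ℝ) := ⟨fun t => x t / δ + (M + 1), by fun_prop⟩
  set N : ℕ := 2 * M + 2 with hN
  have hxs (t : X) : x t = δ * (s t - (M + 1)) := by
    simp only [s, ContinuousMap.coe_mk]; field_simp; ring
  have hs (t : X) : 1 ≤ s t ∧ s t ≤ 2 * M + 1 := by
    have h₁ : |x t| / δ < M :=
      (div_le_div_of_nonneg_right (x.norm_coe_le_norm t) hδ.le).trans_lt hM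
    rw [← abs_of_pos hδ, ← abs_div, abs_lt] at h₁
    simp only [s, ContinuousMap.coe_mk]
    constructor <;> linarith
  have cr := continuous_ramp
  let f : ℕ → C(X, ℝ) := fun i => ⟨fun t => ramp (s t - i) - ramp (s t - i - 1), by fun_prop⟩
  let g : ℕ → C(X, ℝ) := fun i => ⟨fun t => ramp (s t - i + 2) - ramp (s t - i - 3), by fun_prop⟩
  let k : ℕ → C(X, ℝ) := fun i =>
    ⟨fun t => 1 - (ramp (s t - i + 1) - ramp (s t - i - 2)), by fun_prop⟩
  let z : ℕ → ℝ := fun i => δ * (i - (M + 1))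
  let c : ℕ → C(X, ℝ) := fun i => algebraMap ℝ C(X, ℝ) (z i)
  have hsum : ∑ i ∈ Finset.range N, f i = 1 := by
    ext t
    rw [ContinuousMap.sum_apply]
    simp only [f, ContinuousMap.coe_mk, sum_ramp_sub, ContinuousMap.one_apply]
    rw [ramp_of_one_le (hs t).1, ramp_of_nonpos, sub_zero]
    have := (hs t).2
    rw [hN]; push_cast; linarith
  have hk (i : ℕ) : k i * f i = 0 := by
    ext t
    simp only [k, f, ContinuousMap.mul_apply, ContinuousMap.coe_mk, ContinuousMap.zero_apply]
    rcases le_total (s t - i) 0 with h | h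
    · rw [ramp_of_nonpos h, ramp_of_nonpos (by linarith : s t - i - 1 ≤ 0)]; simp
    rcases le_total (s t - i) 2 with h' | h'
    · rw [ramp_of_one_le (by linarith : 1 ≤ s t - i + 1),
        ramp_of_nonpos (by linarith : s t - i - 2 ≤ 0)]; simp
    · rw [ramp_of_one_le (by linarith : 1 ≤ s t - i),
        ramp_of_one_le (by linarith : 1 ≤ s t - i - 1)]; simp
  have hgk (i : ℕ) : (1 - g i) * k i = 1 - g i := by
    ext t
    simp only [k, g, ContinuousMap.mul_apply, ContinuousMap.coe_mk, ContinuousMap.sub_apply,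
      ContinuousMap.one_apply]
    rcases le_total (s t - i) (-1) with h | h
    · rw [ramp_of_nonpos (by linarith : s t - i + 1 ≤ 0),
        ramp_of_nonpos (by linarith : s t - i - 2 ≤ 0)]; simp
    rcases le_total (s t - i) 3 with h' | h'
    · rw [ramp_of_one_le (by linarith : 1 ≤ s t - i + 2),
        ramp_of_nonpos (by linarith : s t - i - 3 ≤ 0)]; simp
    · rw [ramp_of_one_le (by linarith : 1 ≤ s t - i + 1),
        ramp_of_one_le (by linarith : 1 ≤ s t - i - 2)]; simp
  have hx₁ : β x 1 = ∑ i ∈ Finset.range N, β (x * f i) (g i) := by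
    have hx : x = ∑ i ∈ Finset.range N, x * f i := by rw [← Finset.mul_sum, hsum, mul_one]
    conv_lhs => rw [hx, map_sum, LinearMap.sum_apply]
    refine Finset.sum_congr rfl fun i _ => ?_
    rw [← sub_eq_zero, ← map_sub]
    exact hsep _ _ (k i) (hgk i) (by rw [mul_left_comm, hk, mul_zero])
  have hx₂ : β 1 x = ∑ i ∈ Finset.range N, β (f i) (x * g i) := by
    conv_lhs => rw [← hsum, map_sum, LinearMap.sum_apply]
    refine Finset.sum_congr rfl fun i _ => ?_
    rw [← sub_eq_zero, ← map_sub]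
    refine hsep _ _ (k i) ?_ (hk i)
    have : x - x * g i = x * (1 - g i) := by ring
    rw [this, mul_assoc, hgk]
  have hdiff : β x 1 - β 1 x = ∑ i ∈ Finset.range N, β ((x - c i) * f i) (g i) -
      ∑ i ∈ Finset.range N, β (f i) ((x - c i) * g i) := by
    rw [hx₁, hx₂, ← Finset.sum_sub_distrib, ← Finset.sum_sub_distrib]
    refine Finset.sum_congr rfl fun i _ => ?_
    simp only [c, sub_mul, ← Algebra.smul_def, map_sub, map_smul, LinearMap.sub_apply,
      LinearMap.smul_apply]
    abel
  have hxc (i : ℕ) (t : X) : (x - c i) t = δ * (s t - i) := by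
    have : c i t = z i := by simp [c, Algebra.algebraMap_eq_smul_one]
    rw [ContinuousMap.sub_apply, this, hxs t]
    ring
  have hf0 (i : ℕ) (t : X) : 0 ≤ f i t := sub_nonneg.2 (monotone_ramp (by linarith))
  have hg0 (i : ℕ) (t : X) : 0 ≤ g i t := sub_nonneg.2 (monotone_ramp (by linarith))
  have hf1 (t : X) : ∑ i ∈ Finset.range N, f i t = 1 := by
    rw [← ContinuousMap.sum_apply, hsum, ContinuousMap.one_apply]
  have hg5 (t : X) : ∑ i ∈ Finset.range N, g i t ≤ 5 := sum_ramp_sub_wide_le (s t) N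
  have hxf (i : ℕ) (t : X) : |((x - c i) * f i) t| ≤ (2 * δ) * f i t := by
    rw [ContinuousMap.mul_apply, hxc, abs_mul, abs_of_nonneg (hf0 i t), abs_mul, abs_of_pos hδ]
    by_cases h : |s t - i| ≤ 2
    · have := hf0 i t
      gcongr ?_ * _
      nlinarith
    · suffices f i t = 0 by simp [this]
      simp only [f, ContinuousMap.coe_mk]
      rcases lt_abs.1 (not_le.1 h) with h | h
      · rw [ramp_of_one_le (by linarith : 1 ≤ s t - i),
          ramp_of_one_le (by linarith : 1 ≤ s t - i - 1)]; simp
      · rw [ramp_of_nonpos (by linarith : s t - i ≤ 0),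
          ramp_of_nonpos (by linarith : s t - i - 1 ≤ 0)]; simp
  have hxg (i : ℕ) (t : X) : |((x - c i) * g i) t| ≤ (4 * δ) * g i t := by
    rw [ContinuousMap.mul_apply, hxc, abs_mul, abs_of_nonneg (hg0 i t), abs_mul, abs_of_pos hδ]
    by_cases h : |s t - i| ≤ 4
    · have := hg0 i t
      gcongr ?_ * _
      nlinarith
    · suffices g i t = 0 by simp [this]
      simp only [g, ContinuousMap.coe_mk]
      rcases lt_abs.1 (not_le.1 h) with h | h
      · rw [ramp_of_one_le (by linarith : 1 ≤ s t - i + 2),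
          ramp_of_one_le (by linarith : 1 ≤ s t - i - 3)]; simp
      · rw [ramp_of_nonpos (by linarith : s t - i + 2 ≤ 0),
          ramp_of_nonpos (by linarith : s t - i - 3 ≤ 0)]; simp
  have b₁ := norm_sum_bilin_le β hC hβ (Finset.range N) (fun i => (x - c i) * f i) g
    (norm_sum_smul_le_of_abs_le _ _ (fun i => (2 * δ) • f i) (K := 2 * δ) (by positivity)
      (fun i _ t => hxf i t)
      fun t => by simp [← Finset.mul_sum, hf1])
    (norm_sum_smul_le_of_abs_le _ _ g (K := 5) (by norm_num)
      (fun i _ t => (abs_of_nonneg (hg0 i t)).le) hg5)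
  have b₂ := norm_sum_bilin_le β hC hβ (Finset.range N) f (fun i => (x - c i) * g i)
    (norm_sum_smul_le_of_abs_le _ _ f (K := 1) (by norm_num)
      (fun i _ t => (abs_of_nonneg (hf0 i t)).le) fun t => (hf1 t).le)
    (norm_sum_smul_le_of_abs_le _ _ (fun i => (4 * δ) • g i) (K := 4 * δ * 5) (by positivity)
      (fun i _ t => hxg i t)
      fun t => by
        simp only [ContinuousMap.smul_apply, smul_eq_mul, ← Finset.mul_sum]
        gcongr; exact hg5 t)
  rw [hdiff]
  refine (norm_sub_le _ _).trans ?_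
  linarith

/-- A bounded bilinear map on `C(X, ℝ)` vanishing on pairs of functions with separated supports
is balanced. -/
lemma bilin_continuousMap_comm {G : Type*} [NormedAddCommGroup G] [NormedSpace ℝ G]
    (β : C(X, ℝ) →ₗ[ℝ] C(X, ℝ) →ₗ[ℝ] G) {C : ℝ} (hC : 0 ≤ C)
    (hβ : ∀ f g, ‖β f g‖ ≤ C * ‖f‖ * ‖g‖)
    (hsep : ∀ f g k : C(X, ℝ), g * k = g → k * f = 0 → β f g = 0) (x : C(X, ℝ)) :
    β x 1 = β 1 x := by
  rw [← sub_eq_zero, ← norm_le_zero_iff]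
  refine le_of_forall_pos_le_add fun ε hε => ?_
  rw [zero_add]
  refine (norm_bilin_sub_le β hC hβ hsep x (δ := ε / (30 * C + 1)) (by positivity)).trans ?_
  rw [mul_div_assoc', div_le_iff₀ (by positivity)]
  nlinarith

end ContinuousFunctions

section Factorization

variable {A : Type*} [CStarAlgebra A]

/-- Approximate polar-type cut-offs of an element `e`, inside `e A`. -/
lemma exists_cutoff (e : A) {ε : ℝ} (hε : 0 < ε) :
    ∃ p v w : A, p = e * star e * w ∧ p = w * (e * star e) ∧ p * v = v ∧
      (∃ w', v = e * star e * w') ∧ ‖v * e - e‖ ≤ ε := by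
  set P := e * star e with hP
  have hPs : IsSelfAdjoint P := IsSelfAdjoint.mul_star_self e
  let _ := CStarAlgebra.spectralOrder A
  have _ := CStarAlgebra.spectralOrderedRing A
  have hP0 : 0 ≤ P := mul_star_self_nonneg e
  have hη : 0 < ε ^ 2 := by positivity
  set η := ε ^ 2
  let h₁ : ℝ → ℝ := fun t => (max t η)⁻¹
  let u₁ : ℝ → ℝ := fun t => max 0 (t - η) * (max t η)⁻¹ * (max t η)⁻¹
  have hmax (t : ℝ) : max t η ≠ 0 := (lt_max_of_lt_right hη).ne'
  have ch₁ : Continuous h₁ := by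
    simp only [h₁]; exact Continuous.inv₀ (by fun_prop) hmax
  have cu₁ : Continuous u₁ := by
    simp only [u₁]
    have := ch₁
    simp only [h₁] at this
    fun_prop
  have hid : cfc (fun t : ℝ => t) P = P := cfc_id' ℝ P
  have e₁ : P * cfc h₁ P = cfc (fun t => t * h₁ t) P := by
    rw [cfc_mul (fun t : ℝ => t) h₁ P (by fun_prop) ch₁.continuousOn, hid]
  have e₂ : cfc h₁ P * P = cfc (fun t => t * h₁ t) P := by
    rw [← e₁]
    have h := (cfc_commute_cfc h₁ (fun t => t) P).eq
    rwa [hid] at h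
  have e₃ : P * cfc u₁ P = cfc (fun t => t * u₁ t) P := by
    rw [cfc_mul (fun t : ℝ => t) u₁ P (by fun_prop) cu₁.continuousOn, hid]
  refine ⟨P * cfc h₁ P, P * cfc u₁ P, cfc h₁ P, rfl, e₁.trans e₂.symm, ?_, ⟨_, rfl⟩, ?_⟩
  · rw [e₁, e₃, ← cfc_mul _ _ P (by fun_prop) (by fun_prop)]
    congr 1
    ext t
    simp only [h₁, u₁]
    rcases le_total t η with h | h
    · rw [max_eq_left (by linarith : t - η ≤ 0)]; simp
    · rw [max_eq_left h]
      have : t ≠ 0 := (hη.trans_le h).ne'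
      field_simp
  · set v := P * cfc u₁ P with hv
    have hvs : IsSelfAdjoint v := by rw [e₃]; exact cfc_predicate _ P
    have hsq : ‖v * e - e‖ ^ 2 ≤ η := by
      have h₁ : (v * e - e) * star (v * e - e) =
          cfc (fun t : ℝ => (t * u₁ t - 1) * t * (t * u₁ t - 1)) P := by
        rw [cfc_mul _ _ P (by fun_prop) (by fun_prop), cfc_mul _ _ P (by fun_prop) (by fun_prop),
          cfc_sub _ _ P (by fun_prop) (by fun_prop), ← e₃, hid, cfc_const_one ℝ P, hP,
          star_sub, star_mul, hvs.star_eq]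
        noncomm_ring
      rw [sq, ← CStarRing.norm_self_mul_star, h₁]
      refine norm_cfc_le hη.le fun t ht => ?_
      have ht0 : 0 ≤ t := spectrum_nonneg_of_nonneg hP0 ht
      simp only [u₁]
      rcases le_total t η with h | h
      · rw [max_eq_left (by linarith : t - η ≤ 0)]
        simpa [abs_of_nonneg ht0] using h
      · rw [max_eq_left h, max_eq_right (by linarith : 0 ≤ t - η)]
        have htp : 0 < t := hη.trans_le h
        have : (t * ((t - η) * t⁻¹ * t⁻¹) - 1) * t * (t * ((t - η) * t⁻¹ * t⁻¹) - 1)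
            = η * (η / t) := by field_simp; ring
        rw [this, Real.norm_of_nonneg (by positivity)]
        exact mul_le_of_le_one_right hη.le ((div_le_one htp).2 h)
    exact (pow_le_pow_iff_left₀ (norm_nonneg _) hε.le two_ne_zero).1 hsq

end Factorization

lemma mul_eq_zero_of_star_mul_mul_eq_zero {B : Type*} [CStarAlgebra B] {a x : B}
    (h : star a * a * x = 0) : a * x = 0 := by
  rw [← CStarRing.star_mul_self_eq_zero_iff, star_mul, mul_assoc, ← mul_assoc (star a), h,
    mul_zero]

lemma eq_zero_of_eq_neg {B : Type*} [AddCommGroup B] [Module ℂ B] {y : B} (h : y = -y) :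
    y = 0 := by
  have h₂ : (2 : ℂ) • y = 0 := by rw [two_smul]; exact add_eq_zero_iff_eq_neg.2 h
  exact (smul_eq_zero.1 h₂).resolve_left two_ne_zero

section TripleDerivation

variable {A B : Type*} [CStarAlgebra A] [CStarAlgebra B] (ι : A →⋆ₐ[ℂ] B) (T S : A →L[ℂ] B)

/-- The linearised form of being a triple derivation at zero, where `S` plays the role of
`b ↦ (T b*)*`. -/
def TripleDerivableAtZero : Prop :=
  ∀ a b c : A, a * b * c + c * b * a = 0 →
    T a * ι b * ι c + ι c * ι b * T a + (ι a * S b * ι c + ι c * S b * ι a) +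
      (ι a * ι b * T c + T c * ι b * ι a) = 0

variable {ι T S}

namespace TripleDerivableAtZero

lemma swap (H : TripleDerivableAtZero ι T S) {a b c : A} (hab : a * b = 0) (hcb : c * b = 0) :
    (T a * ι b + ι a * S b) * ι c + (T c * ι b + ι c * S b) * ι a = 0 := by
  have h := H a b c (by rw [hab, hcb]; simp)
  have h₁ : ι a * ι b = 0 := by rw [← map_mul, hab, map_zero]
  have h₂ : ι c * ι b = 0 := by rw [← map_mul, hcb, map_zero]
  rw [h₁, h₂] at h
  rw [← h]
  noncomm_ring

lemma of_orthogonal (H : TripleDerivableAtZero ι T S) {a b : A} (hab : a * b = 0)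
    (hba : b * a = 0) : T a * ι b + ι a * S b = 0 := by
  have iab : ι a * ι b = 0 := by rw [← map_mul, hab, map_zero]
  have iba : ι b * ι a = 0 := by rw [← map_mul, hba, map_zero]
  set m := T a * ι b + ι a * S b with hm
  set n := ι b * T a + S b * ι a with hn
  have key (c : A) : m * ι c + ι c * n = 0 := by
    have h := H a b c (by rw [hab, mul_assoc, hba]; simp)
    rw [iab, mul_assoc (T c), iba] at h
    rw [← h, hm, hn]
    noncomm_ring
  have hnm : n = -m := by
    have := key 1
    simp only [map_one, mul_one, one_mul] at this
    exact eq_neg_of_add_eq_zero_right this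
  have comm (c : A) : m * ι c = ι c * m := by
    have := key c
    rw [hnm, mul_neg, ← sub_eq_add_neg, sub_eq_zero] at this
    exact this
  have hma : m * ι a = 0 := by
    apply eq_zero_of_eq_neg
    have h₁ : m * ι a = ι a * S b * ι a := by
      rw [hm, add_mul, mul_assoc (T a), iba, mul_zero, zero_add]
    have h₂ : ι a * n = ι a * S b * ι a := by
      rw [hn, mul_add, ← mul_assoc, iab, zero_mul, zero_add, mul_assoc]
    rw [hnm, mul_neg, ← comm, ← h₁] at h₂
    exact h₂.symm
  have hmb : m * ι b = 0 := by
    apply eq_zero_of_eq_neg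
    have h₁ : ι b * m = ι b * T a * ι b := by
      rw [hm, mul_add, ← mul_assoc (ι b) (ι a), iba, zero_mul, add_zero, mul_assoc]
    have h₂ : n * ι b = ι b * T a * ι b := by
      rw [hn, add_mul, mul_assoc (S b), iab, mul_zero, add_zero]
    rw [hnm, neg_mul, ← h₁, ← comm] at h₂
    exact h₂.symm
  have star_zero' {c : A} (h : m * ι c = 0) : m * ι (star c) = 0 := by
    rw [← CStarRing.mul_star_self_eq_zero_iff, star_mul, ← map_star, star_star, ← mul_assoc,
      comm, mul_assoc (ι (star c)), h]
    simp
  have hbm : ι b * star m = 0 := by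
    have := congrArg star (star_zero' hmb)
    rwa [star_mul, ← map_star, star_star, star_zero] at this
  have hmm : m * star m = ι a * (S b * star m) := by
    conv_lhs => rw [hm]
    rw [add_mul, mul_assoc (T a), hbm, mul_zero, zero_add, mul_assoc]
  have : ι a * (S b * star m) = 0 := by
    apply mul_eq_zero_of_star_mul_mul_eq_zero
    rw [mul_assoc, ← hmm, ← map_star, ← mul_assoc, ← comm, star_zero' hma, zero_mul]
  rw [this] at hmm
  exact CStarRing.mul_star_self_eq_zero_iff m |>.1 hmm

lemma of_square_zero (H : TripleDerivableAtZero ι T S) {e b : A} (heb : e * b = 0)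
    (hbe : b * star e = 0) (hee : e * e = 0) : T e * ι b + ι e * S b = 0 := by
  have hcont : Continuous fun y : A => T y * ι b + ι y * S b := by
    have : Continuous ι := map_continuous ι
    fun_prop
  suffices h : ∀ ε : ℝ, 0 < ε → ∃ y, ‖y - e‖ ≤ ε ∧ T y * ι b + ι y * S b = 0 by
    have hcl : IsClosed {y : A | T y * ι b + ι y * S b = 0} := isClosed_eq hcont continuous_const
    have : e ∈ closure {y : A | T y * ι b + ι y * S b = 0} := by
      refine Metric.mem_closure_iff.2 fun ε hε => ?_
      obtain ⟨y, hy, hy0⟩ := h (ε / 2) (by positivity)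
      exact ⟨y, hy0, by rw [dist_comm, dist_eq_norm]; linarith⟩
    rwa [hcl.closure_eq] at this
  intro ε hε
  obtain ⟨p, v, w, hp₁, hp₂, hpv, ⟨w', hw'⟩, hve⟩ := exists_cutoff e hε
  refine ⟨v * e, hve, ?_⟩
  have hsee : star e * star e = 0 := by rw [← star_mul, hee, star_zero]
  have hΦe : (T e * ι b + ι e * S b) * ι e = 0 := eq_zero_of_eq_neg
    (eq_neg_of_add_eq_zero_left (H.swap heb heb))
  have hveb : v * e * b = 0 := by rw [mul_assoc, heb, mul_zero]
  have hΦve : (T (v * e) * ι b + ι (v * e) * S b) * ι e = 0 := by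
    have h := H.swap hveb heb
    have : ι (v * e) = ι e * ι (star e * w' * e) := by
      rw [← map_mul, hw']; simp only [mul_assoc]
    conv at h => lhs; arg 2; rw [this, ← mul_assoc, hΦe, zero_mul]
    simpa using h
  have hΦp : (T (v * e) * ι b + ι (v * e) * S b) * ι p = 0 := by
    rw [hp₁, mul_assoc e, map_mul ι e, ← mul_assoc, hΦve, zero_mul]
  have hbp : b * (1 - p) * (v * e) = 0 := by
    have : (1 - p) * v = 0 := by rw [sub_mul, hpv, one_mul, sub_self]
    rw [mul_assoc, ← mul_assoc (1 - p), this]; simp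
  have h₁ := H.of_orthogonal (a := v * e) (b := b * (1 - p))
    (by rw [← mul_assoc, hveb, zero_mul]) hbp
  have hQb : star e * e * b = 0 := by rw [mul_assoc, heb, mul_zero]
  have hbQ : b * (star e * e) = 0 := by rw [← mul_assoc, hbe, zero_mul]
  have hpQ : p * (star e * e) = 0 := by
    rw [hp₂, mul_assoc, mul_assoc e, ← mul_assoc (star e) (star e), hsee]; simp
  have h₂ := H.of_orthogonal hQb hbQ
  have h₃ := H.of_orthogonal (a := star e * e) (b := b * (1 - p))
    (by rw [← mul_assoc, hQb, zero_mul])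
    (by rw [mul_assoc, sub_mul, hpQ, sub_zero, one_mul, hbQ])
  have hX : ι e * (S b * ι (1 - p) - S (b * (1 - p))) = 0 := by
    apply mul_eq_zero_of_star_mul_mul_eq_zero
    rw [← map_star, ← map_mul, mul_sub, ← mul_assoc, eq_neg_of_add_eq_zero_right h₂,
      eq_neg_of_add_eq_zero_right h₃, map_mul ι b]
    noncomm_ring
  have hsplit : T (v * e) * ι b + ι (v * e) * S b =
      (T (v * e) * ι b + ι (v * e) * S b) * ι (1 - p) := by
    rw [map_sub, map_one, mul_sub, hΦp, mul_one, sub_zero]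
  calc T (v * e) * ι b + ι (v * e) * S b
      = (T (v * e) * ι b + ι (v * e) * S b) * ι (1 - p) := hsplit
    _ = (T (v * e) * ι (b * (1 - p)) + ι (v * e) * S (b * (1 - p))) +
        ι v * (ι e * (S b * ι (1 - p) - S (b * (1 - p)))) := by
      rw [map_mul ι b, map_mul ι v]; noncomm_ring
    _ = 0 := by rw [h₁, hX]; simp

lemma of_separated (H : TripleDerivableAtZero ι T S) (a : A) {f g k : A}
    (hf : IsSelfAdjoint f) (hk : IsSelfAdjoint k) (hg : IsSelfAdjoint g)
    (hgk : g * k = g) (hkf : k * f = 0) : T (a * f) * ι g + ι (a * f) * S g = 0 := by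
  have hfk : f * k = 0 := by
    have := congrArg star hkf
    rwa [star_mul, hf.star_eq, hk.star_eq, star_zero] at this
  have hgf : g * f = 0 := by rw [← hgk, mul_assoc, hkf, mul_zero]
  have hfg : f * g = 0 := by
    have := congrArg star hgf
    rwa [star_mul, hf.star_eq, hg.star_eq, star_zero] at this
  have h₁ := H.of_square_zero (e := k * a * f) (b := g) (by rw [mul_assoc, hfg, mul_zero])
    (by rw [star_mul, hf.star_eq, ← mul_assoc, hgf, zero_mul])
    (by rw [mul_assoc, mul_assoc k a f, ← mul_assoc f, hfk]; simp)
  have h₂ := H.of_orthogonal (a := (1 - k) * a * f) (b := g) (by rw [mul_assoc, hfg, mul_zero])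
    (by rw [← mul_assoc, ← mul_assoc, mul_sub, hgk, mul_one, sub_self]; simp)
  have : a * f = k * a * f + (1 - k) * a * f := by noncomm_ring
  rw [this, map_add, map_add]
  calc _ = (T (k * a * f) * ι g + ι (k * a * f) * S g) +
      (T ((1 - k) * a * f) * ι g + ι ((1 - k) * a * f) * S g) := by noncomm_ring
    _ = 0 := by rw [h₁, h₂, add_zero]

lemma balanced_of_isSelfAdjoint (H : TripleDerivableAtZero ι T S) (a : A) {x : A}
    (hx : IsSelfAdjoint x) : T (a * x) + ι (a * x) * S 1 = T a * ι x + ι a * S x := by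
  let ψ := cfcHom (R := ℝ) hx
  have hψn (f) : ‖ψ f‖ = ‖f‖ := norm_cfcHom x f hx
  have hψs (f) : IsSelfAdjoint (ψ f) := cfcHom_predicate hx f
  let β : C(spectrum ℝ x, ℝ) →ₗ[ℝ] C(spectrum ℝ x, ℝ) →ₗ[ℝ] B :=
    LinearMap.mk₂ ℝ (fun f g => T (a * ψ f) * ι (ψ g) + ι (a * ψ f) * S (ψ g))
      (fun f f' g => by simp only [map_add, mul_add, add_mul]; abel)
      (fun r f g => by
        have h (y : A) : ι (r • y) = r • ι y := (ι : A →ₗ[ℂ] B).map_smul_of_tower r y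
        have h' (y : A) : T (r • y) = r • T y := (T : A →ₗ[ℂ] B).map_smul_of_tower r y
        simp only [map_smul, mul_smul_comm, h, h', smul_mul_assoc, smul_add])
      (fun f g g' => by simp only [map_add, mul_add]; abel)
      (fun r f g => by
        have h (y : A) : ι (r • y) = r • ι y := (ι : A →ₗ[ℂ] B).map_smul_of_tower r y
        have h' (y : A) : S (r • y) = r • S y := (S : A →ₗ[ℂ] B).map_smul_of_tower r y
        simp only [map_smul, mul_smul_comm, h, h', smul_add])
  have hι (y : A) : ‖ι y‖ ≤ ‖y‖ := NonUnitalStarAlgHom.norm_apply_le ι y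
  have key := bilin_continuousMap_comm β (C := ‖T‖ * ‖a‖ + ‖a‖ * ‖S‖) (by positivity)
    (fun f g => ?_)
    (fun f g k hgk hkf => H.of_separated a (hψs f) (hψs k) (hψs g)
      (by rw [← map_mul, hgk]) (by rw [← map_mul, hkf, map_zero]))
    ((ContinuousMap.id ℝ).restrict (spectrum ℝ x))
  · have hid : ψ ((ContinuousMap.id ℝ).restrict (spectrum ℝ x)) = x := cfcHom_id hx
    simpa [β, hid] using key
  · calc ‖T (a * ψ f) * ι (ψ g) + ι (a * ψ f) * S (ψ g)‖
        ≤ ‖T (a * ψ f)‖ * ‖ι (ψ g)‖ + ‖ι (a * ψ f)‖ * ‖S (ψ g)‖ :=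
          (norm_add_le _ _).trans (add_le_add (norm_mul_le _ _) (norm_mul_le _ _))
      _ ≤ (‖T‖ * (‖a‖ * ‖ψ f‖)) * ‖ψ g‖ + (‖a‖ * ‖ψ f‖) * (‖S‖ * ‖ψ g‖) := by
          gcongr
          · exact (T.le_opNorm _).trans (by gcongr; exact norm_mul_le _ _)
          · exact hι _
          · exact (hι _).trans (norm_mul_le _ _)
          · exact S.le_opNorm _
      _ = (‖T‖ * ‖a‖ + ‖a‖ * ‖S‖) * ‖f‖ * ‖g‖ := by rw [hψn, hψn]; ring

lemma balanced (H : TripleDerivableAtZero ι T S) (a x : A) :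
    T (a * x) + ι (a * x) * S 1 = T a * ι x + ι a * S x := by
  have h₁ := H.balanced_of_isSelfAdjoint a (ℜ x).2
  have h₂ := H.balanced_of_isSelfAdjoint a (ℑ x).2
  have hx := realPart_add_I_smul_imaginaryPart x
  rw [← hx]
  calc _ = (T (a * (ℜ x : A)) + ι (a * (ℜ x : A)) * S 1) +
        Complex.I • (T (a * (ℑ x : A)) + ι (a * (ℑ x : A)) * S 1) := by
        simp only [mul_add, map_add, mul_smul_comm, map_smul, add_mul, smul_mul_assoc, smul_add]
        abel
    _ = _ := by
        rw [h₁, h₂]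
        simp only [mul_add, map_add, mul_smul_comm, map_smul, smul_add]
        abel

theorem map_mul_eq (H : TripleDerivableAtZero ι T S) (x y : A) :
    T (x * y) = T x * ι y + ι x * T y - ι x * T 1 * ι y := by
  have h := H.balanced x y
  have h₁ := H.balanced 1 y
  rw [one_mul, map_one ι, one_mul] at h₁
  rw [eq_sub_of_add_eq h, eq_sub_of_add_eq h₁, map_mul]
  noncomm_ring

end TripleDerivableAtZero

end TripleDerivation

/-- A bounded linear map `T : A → B` on a C*-subalgebra `A` (containing the unit) of a unital
C*-algebra `B` which is a triple derivation at zero is a generalized derivation. -/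
theorem stmt8 {B : Type*} [CStarAlgebra B] (A : StarSubalgebra ℂ B)
    (hA : IsClosed (A : Set B)) (T : A →ₗ[ℂ] B) (hcont : Continuous T)
    (hT : ∀ a b c : A, trip (a : B) (b : B) (c : B) = 0 →
      trip (T a) (b : B) (c : B) + trip (a : B) (T b) (c : B)
        + trip (a : B) (b : B) (T c) = 0) :
    ∀ x y : A, T (x * y) = T x * (y : B) + (x : B) * T y - (x : B) * T 1 * (y : B) := by
  have : IsClosed (A : Set B) := hA
  let T' : A →L[ℂ] B := ⟨T, hcont⟩
  let S : A →L[ℂ] B :=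
    { toFun := fun b => star (T (star b))
      map_add' := fun b c => by simp
      map_smul' := fun r b => by simp [star_smul]
      cont := by fun_prop }
  have H : TripleDerivableAtZero A.subtype T' S := by
    intro a b c habc
    have h := hT a (star b) c (by
      have := congrArg (Subtype.val) habc
      push_cast at this
      simp [trip, this])
    simp only [trip, StarMemClass.coe_star, star_star, ← smul_add] at h
    exact (smul_eq_zero.1 h).resolve_left (by norm_num)
  exact H.map_mul_eq
end

section
/- Let A be a unital C*-algebra and let T : A → A be a bounded linear map which is a triple derivation at zero and satisfies T(1)* = −T(1). Then T is a triple derivation. -/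
open Complex in
/-- A bounded bilinear map on `C(K, ℂ)` vanishing on pairs of functions with zero product
satisfies `φ f 1 = φ 1 f` for real functions `f` with values in `[0, R]`. -/
lemma ContinuousMap.bilin_comm_one_of_nonneg {K E : Type*} [TopologicalSpace K] [CompactSpace K]
    [NormedAddCommGroup E] [NormedSpace ℂ E]
    (φ : C(K, ℂ) →ₗ[ℂ] C(K, ℂ) →ₗ[ℂ] E) (C : ℝ) (hC0 : 0 ≤ C)
    (hC : ∀ f g, ‖φ f g‖ ≤ C * ‖f‖ * ‖g‖)
    (hφ : ∀ f g, f * g = 0 → φ f g = 0) (r : C(K, ℝ)) (R : ℝ) (hR : 0 < R)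
    (hr0 : ∀ t, 0 ≤ r t) (hrR : ∀ t, r t ≤ R)
    (f : C(K, ℂ)) (hf : ∀ t, f t = (r t : ℂ)) : φ f 1 = φ 1 f := by
  -- at mesh `δ = R / N`, `f` is a sum of layers `c k`, on which `φ` is computed by orthogonality
  have key : ∀ N : ℕ, 0 < N → 2 * (R / N) * ‖φ f 1 - φ 1 f‖ ≤ 18 * C * (R / N) ^ 2 := by
    intro N hN
    have hN' : (0 : ℝ) < N := by exact_mod_cast hN
    set δ : ℝ := R / N with hδ
    have hδ0 : 0 < δ := by positivity
    let c : ℕ → C(K, ℂ) := fun k =>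
      ⟨fun t => ((max 0 (min (r t - k * δ) δ) : ℝ) : ℂ), by fun_prop⟩
    have hc : ∀ k t, c k t = ((max 0 (min (r t - k * δ) δ) : ℝ) : ℂ) := fun _ _ => rfl
    have hc_zero : ∀ (k : ℕ) t, r t ≤ k * δ → c k t = 0 := by
      intro k t h
      rw [hc, max_eq_left ((min_le_left _ _).trans (by linarith))]; simp
    have hc_full : ∀ (k : ℕ) t, (k + 1 : ℝ) * δ ≤ r t → c k t = δ := by
      intro k t h
      rw [hc, min_eq_right (by linarith), max_eq_right hδ0.le]
    have hc_mid : ∀ (k : ℕ) t, k * δ ≤ r t → r t ≤ (k + 1 : ℝ) * δ →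
        c k t = ((r t - k * δ : ℝ) : ℂ) := by
      intro k t h h'
      rw [hc, min_eq_left (by linarith), max_eq_right (by linarith)]
    have hc_norm : ∀ (k : ℕ) t, ‖c k t‖ ≤ δ := by
      intro k t
      rw [hc, Complex.norm_real, Real.norm_eq_abs, abs_of_nonneg (le_max_left _ _)]
      exact max_le hδ0.le (min_le_right _ _)
    have horth : ∀ j k : ℕ, j < k → c k * (c j - (δ : ℂ) • 1) = 0 := by
      intro j k hjk
      ext t
      rcases le_total (r t) (k * δ) with h | h
      · simp [hc_zero k t h]
      · have : (j + 1 : ℝ) ≤ k := by exact_mod_cast hjk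
        have := hc_full j t ((mul_le_mul_of_nonneg_right this hδ0.le).trans h)
        simp [this]
    let w : ℂ → ℕ → C(K, ℂ) := fun ι n =>
      (δ : ℂ) • 1 + ∑ k ∈ Finset.range n, (ι ^ k * (ι - 1)) • c k
    have hw_succ : ∀ ι n, w ι (n + 1) = w ι n + (ι ^ n * (ι - 1)) • c n := by
      intro ι n
      simp only [w, Finset.sum_range_succ, add_assoc]
    have hw_orth : ∀ ι (n k : ℕ), n ≤ k → c k * (w ι n - ((δ : ℂ) * ι ^ n) • 1) = 0 := by
      intro ι n
      induction n with
      | zero => intro k _; simp [w]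
      | succ n ih =>
        intro k hk
        have e : w ι (n + 1) - ((δ : ℂ) * ι ^ (n + 1)) • 1 =
            (w ι n - ((δ : ℂ) * ι ^ n) • 1) + (ι ^ n * (ι - 1)) • (c n - (δ : ℂ) • 1) := by
          rw [hw_succ]; module
        rw [e, mul_add, ih k (by omega), mul_smul_comm, horth n k (by omega)]
        simp
    have hleft : ∀ ι n, φ (c n) (w ι n) = ((δ : ℂ) * ι ^ n) • φ (c n) 1 := by
      intro ι n
      have := hφ _ _ (hw_orth ι n n le_rfl)
      rwa [map_sub, map_smul, sub_eq_zero] at this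
    have hright : ∀ ι n, φ (w ι n) (c n) = ((δ : ℂ) * ι ^ n) • φ 1 (c n) := by
      intro ι n
      have := hφ _ _ ((mul_comm _ _).trans (hw_orth ι n n le_rfl))
      rwa [map_sub, map_smul, LinearMap.sub_apply, LinearMap.smul_apply, sub_eq_zero] at this
    have hsum : ∀ n, φ (w I n) (w (-I) n) - φ (w (-I) n) (w I n) =
        (2 * I * δ) • ∑ k ∈ Finset.range n, (φ (c k) 1 - φ 1 (c k)) := by
      intro n
      induction n with
      | zero => simp [w]
      | succ n ih =>
        have hpow : I ^ n * (-I) ^ n = 1 := by rw [← mul_pow]; simp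
        have e1 : I ^ n * (I - 1) * (δ * (-I) ^ n) = (I - 1) * δ := by
          linear_combination (I - 1) * δ * hpow
        have e2 : (-I) ^ n * (-I - 1) * (δ * I ^ n) = (-I - 1) * δ := by
          linear_combination (-I - 1) * δ * hpow
        rw [Finset.sum_range_succ, smul_add, ← ih, hw_succ, hw_succ]
        simp only [map_add, map_smul, LinearMap.add_apply, LinearMap.smul_apply, hleft, hright,
          smul_add, smul_smul, e1, e2]
        module
    have hw_norm : ∀ ι : ℂ, ‖ι‖ = 1 → ∀ n, ‖w ι n‖ ≤ 3 * δ := by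
      intro ι hι n
      rw [ContinuousMap.norm_le _ (by positivity)]
      intro t
      have : ‖w ι n t‖ ≤ 3 * δ ∧ (n * δ ≤ r t → w ι n t = δ * ι ^ n) := by
        induction n with
        | zero =>
          simp only [w, Finset.range_zero, Finset.sum_empty, add_zero]
          simp [abs_of_pos hδ0]
          linarith
        | succ n ih =>
          have e : w ι (n + 1) t = w ι n t + ι ^ n * (ι - 1) * c n t := by rw [hw_succ]; simp
          rw [e]
          rcases le_total (r t) (n * δ) with h | h
          · rw [hc_zero n t h]
            refine ⟨by simpa using ih.1, fun h' => ?_⟩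
            push_cast at h'
            linarith
          · rw [ih.2 h]
            constructor
            · have h2 : ‖ι - 1‖ ≤ 2 := (norm_sub_le _ _).trans (by rw [hι]; norm_num)
              calc ‖δ * ι ^ n + ι ^ n * (ι - 1) * c n t‖
                  ≤ ‖δ * ι ^ n‖ + ‖ι ^ n * (ι - 1) * c n t‖ := norm_add_le _ _
                _ = δ + ‖ι - 1‖ * ‖c n t‖ := by
                  simp [hι, abs_of_pos hδ0]
                _ ≤ δ + 2 * δ := by gcongr; exact hc_norm n t
                _ = 3 * δ := by ring
            · intro h'
              push_cast at h'
              rw [hc_full n t h']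
              ring
      exact this.1
    have hc_sum : f = ∑ k ∈ Finset.range N, c k := by
      have aux : ∀ (n : ℕ) t, ∑ k ∈ Finset.range n, c k t = ((min (r t) (n * δ) : ℝ) : ℂ) := by
        intro n t
        induction n with
        | zero => simp [hr0 t]
        | succ n ih =>
          rw [Finset.sum_range_succ, ih]
          rcases le_total (r t) (n * δ) with h | h
          · rw [hc_zero n t h, min_eq_left h, min_eq_left (by push_cast; linarith)]; simp
          · rcases le_total (r t) ((n + 1 : ℝ) * δ) with h' | h'
            · rw [hc_mid n t h h', min_eq_right h, min_eq_left (by push_cast; linarith)]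
              push_cast; ring
            · rw [hc_full n t h', min_eq_right h, min_eq_right (by push_cast; linarith)]
              push_cast; ring
      ext t
      have hNδ : N * δ = R := by rw [hδ]; field_simp
      rw [ContinuousMap.sum_apply, aux, hNδ, min_eq_left (hrR t), hf]
    have hfin := hsum N
    rw [Finset.sum_sub_distrib, ← map_sum, ← hc_sum] at hfin
    have hfin' : ∑ k ∈ Finset.range N, φ (c k) 1 = φ f 1 := by
      rw [hc_sum, map_sum, LinearMap.sum_apply]
    rw [hfin'] at hfin
    have hn := congrArg norm hfin
    rw [norm_smul] at hn
    have h2 : ‖(2 * I * δ : ℂ)‖ = 2 * δ := by simp [abs_of_pos hδ0]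
    rw [h2] at hn
    rw [← hn]
    have hp := hw_norm I (by simp) N
    have hm := hw_norm (-I) (by simp) N
    have b1 : ‖φ (w I N) (w (-I) N)‖ ≤ C * (3 * δ) * (3 * δ) := (hC _ _).trans (by gcongr)
    have b2 : ‖φ (w (-I) N) (w I N)‖ ≤ C * (3 * δ) * (3 * δ) := (hC _ _).trans (by gcongr)
    calc _ ≤ _ := norm_sub_le _ _
      _ ≤ C * (3 * δ) * (3 * δ) + C * (3 * δ) * (3 * δ) := add_le_add b1 b2
      _ = 18 * C * δ ^ 2 := by ring
  have hlim : Filter.Tendsto (fun N : ℕ => 9 * C * R / N) Filter.atTop (nhds 0) :=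
    tendsto_const_div_atTop_nhds_zero_nat _
  have hle : ‖φ f 1 - φ 1 f‖ ≤ 0 := by
    refine ge_of_tendsto hlim ?_
    filter_upwards [Filter.eventually_gt_atTop 0] with N hN
    have hN' : (0 : ℝ) < N := by exact_mod_cast hN
    have hδ0 : 0 < R / N := by positivity
    have h := key N hN
    have e : 9 * C * R / N = 9 * C * (R / N) := by ring
    rw [e]
    have : 2 * (R / N) * ‖φ f 1 - φ 1 f‖ ≤ 2 * (R / N) * (9 * C * (R / N)) := by
      linarith
    exact le_of_mul_le_mul_left this (by positivity)
  exact sub_eq_zero.mp (norm_le_zero_iff.mp hle)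

/-- A bounded bilinear map on `C(K, ℂ)` vanishing on pairs of functions with zero product
satisfies `φ f 1 = φ 1 f` for real functions `f`. -/
lemma ContinuousMap.bilin_comm_one {K E : Type*} [TopologicalSpace K] [CompactSpace K]
    [NormedAddCommGroup E] [NormedSpace ℂ E]
    (φ : C(K, ℂ) →ₗ[ℂ] C(K, ℂ) →ₗ[ℂ] E) (C : ℝ) (hC0 : 0 ≤ C)
    (hC : ∀ f g, ‖φ f g‖ ≤ C * ‖f‖ * ‖g‖)
    (hφ : ∀ f g, f * g = 0 → φ f g = 0) (f : C(K, ℂ)) (hf : star f = f) : φ f 1 = φ 1 f := by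
  set R : ℝ := ‖f‖ + 1 with hR
  have hre : ∀ t, |(f t).re| ≤ R := fun t =>
    (Complex.abs_re_le_norm _).trans ((f.norm_coe_le_norm t).trans (by simp [hR]))
  have hreal : ∀ t, f t = ((f t).re : ℂ) := by
    intro t
    have := congrArg (fun g : C(K, ℂ) => g t) hf
    exact (Complex.conj_eq_iff_re.mp this).symm
  have hRpos : 0 < R := by positivity
  have h := ContinuousMap.bilin_comm_one_of_nonneg φ C hC0 hC hφ ⟨fun t => (f t).re + R, by fun_prop⟩
    (2 * R) (by positivity) (fun t => by have := abs_le.mp (hre t); simp; linarith)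
    (fun t => by have := abs_le.mp (hre t); simp; linarith) (f + (R : ℂ) • 1)
    (fun t => by simp [← hreal t])
  simpa using h

/-- A bounded bilinear map on `C(K, ℂ)` vanishing on pairs of functions with zero product
satisfies `φ (f * f) 1 = φ f f` for real functions `f`. -/
lemma ContinuousMap.bilin_mul_self {K E : Type*} [TopologicalSpace K] [CompactSpace K]
    [NormedAddCommGroup E] [NormedSpace ℂ E]
    (φ : C(K, ℂ) →ₗ[ℂ] C(K, ℂ) →ₗ[ℂ] E) (C : ℝ) (hC0 : 0 ≤ C)
    (hC : ∀ f g, ‖φ f g‖ ≤ C * ‖f‖ * ‖g‖)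
    (hφ : ∀ f g, f * g = 0 → φ f g = 0) (f : C(K, ℂ)) (hf : star f = f) :
    φ (f * f) 1 = φ f f := by
  have h := ContinuousMap.bilin_comm_one (φ ∘ₗ LinearMap.mulLeft ℂ f) (C * ‖f‖) (by positivity)
    (fun g k => (hC _ _).trans (by
      rw [LinearMap.mulLeft_apply, mul_assoc C ‖f‖]
      gcongr
      exact norm_mul_le f g))
    (fun g k hgk => hφ _ _ (by rw [LinearMap.mulLeft_apply, mul_assoc, hgk, mul_zero])) f hf
  simpa using h

section CStarAlgebra

variable {A : Type*} [CStarAlgebra A]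

lemma trip_star_one_eq_zero {a b : A} (h : a * b = 0) (h' : b * a = 0) : trip a (star b) 1 = 0 := by
  simp [trip, h, h']

/-- On a self-adjoint element, a bounded triple derivation at zero annihilating the unit takes
a self-adjoint value and satisfies the Jordan derivation identity. -/
lemma jordan_of_triple_derivation_at_zero (T : A →ₗ[ℂ] A) (hcont : Continuous T)
    (hT : ∀ a b c : A, trip a b c = 0 →
      trip (T a) b c + trip a (T b) c + trip a b (T c) = 0)
    (h1 : T 1 = 0) (x : A) (hx : IsSelfAdjoint x) :
    star (T x) = T x ∧ T (x * x) = T x * x + x * T x := by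
  have hxn : IsStarNormal x := hx.isStarNormal
  let Φ : C(spectrum ℂ x, ℂ) →⋆ₐ[ℂ] A := cfcHom hxn
  have hΦn : ∀ f, ‖Φ f‖ = ‖f‖ := fun f => norm_cfcHom x f hxn
  let f₀ : C(spectrum ℂ x, ℂ) := (ContinuousMap.id ℂ).restrict (spectrum ℂ x)
  have hΦ₀ : Φ f₀ = x := cfcHom_id hxn
  have hf₀ : star f₀ = f₀ := (cfcHom_isClosedEmbedding hxn).injective (by
    change Φ (star f₀) = Φ f₀
    rw [map_star, hΦ₀, hx.star_eq])
  let L : A →L[ℂ] A := ⟨T, hcont⟩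
  have hL : ∀ a, ‖T a‖ ≤ ‖L‖ * ‖a‖ := fun a => L.le_opNorm a
  let φ : C(spectrum ℂ x, ℂ) →ₗ[ℂ] C(spectrum ℂ x, ℂ) →ₗ[ℂ] A :=
    LinearMap.mk₂ ℂ (fun f g => T (Φ f) * Φ g + Φ g * T (Φ f) +
        (Φ f * star (T (star (Φ g))) + star (T (star (Φ g))) * Φ f))
      (by intros; simp only [map_add, mul_add, add_mul]; abel)
      (by intros; simp only [map_smul, mul_smul_comm, smul_mul_assoc, smul_add])
      (by intros; simp only [map_add, star_add, mul_add, add_mul]; abel)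
      (by intros; simp only [map_smul, star_smul, mul_smul_comm, smul_mul_assoc, smul_add,
        star_star])
  have hφ_apply : ∀ f g, φ f g = T (Φ f) * Φ g + Φ g * T (Φ f) +
      (Φ f * star (T (star (Φ g))) + star (T (star (Φ g))) * Φ f) := fun _ _ => rfl
  have hφ : ∀ f g, f * g = 0 → φ f g = 0 := by
    intro f g hfg
    have h := hT (Φ f) (star (Φ g)) 1 (trip_star_one_eq_zero
      (by rw [← map_mul, hfg, map_zero]) (by rw [← map_mul, mul_comm, hfg, map_zero]))
    rw [h1] at h
    simp only [trip, star_star, mul_one, one_mul, mul_zero, zero_mul, add_zero, smul_zero] at h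
    rw [← smul_add, smul_eq_zero] at h
    exact h.resolve_left (by norm_num)
  have hC : ∀ f g, ‖φ f g‖ ≤ 4 * ‖L‖ * ‖f‖ * ‖g‖ := by
    intro f g
    have b1 : ‖T (Φ f)‖ ≤ ‖L‖ * ‖f‖ := by simpa [hΦn] using hL (Φ f)
    have b2 : ‖star (T (star (Φ g)))‖ ≤ ‖L‖ * ‖g‖ := by simpa [hΦn] using hL (star (Φ g))
    have p1 : ‖T (Φ f) * Φ g‖ ≤ ‖L‖ * ‖f‖ * ‖g‖ :=
      (norm_mul_le _ _).trans (by rw [hΦn]; gcongr)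
    have p2 : ‖Φ g * T (Φ f)‖ ≤ ‖g‖ * (‖L‖ * ‖f‖) :=
      (norm_mul_le _ _).trans (by rw [hΦn]; gcongr)
    have p3 : ‖Φ f * star (T (star (Φ g)))‖ ≤ ‖f‖ * (‖L‖ * ‖g‖) :=
      (norm_mul_le _ _).trans (by rw [hΦn]; gcongr)
    have p4 : ‖star (T (star (Φ g))) * Φ f‖ ≤ ‖L‖ * ‖g‖ * ‖f‖ :=
      (norm_mul_le _ _).trans (by rw [hΦn]; gcongr)
    rw [hφ_apply]
    refine (norm_add_le_of_le (norm_add_le_of_le p1 p2) (norm_add_le_of_le p3 p4)).trans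
      (le_of_eq (by ring))
  have hstar : star (T x) = T x := by
    have h := ContinuousMap.bilin_comm_one φ _ (by positivity) hC hφ f₀ hf₀
    simp only [hφ_apply, map_one, hΦ₀, star_one, h1, star_zero, mul_zero, zero_mul, mul_one,
      one_mul, add_zero, zero_add, hx.star_eq] at h
    rw [← two_smul ℂ, ← two_smul ℂ (star (T x))] at h
    exact (smul_right_injective A two_ne_zero h).symm
  refine ⟨hstar, ?_⟩
  have h := ContinuousMap.bilin_mul_self φ _ (by positivity) hC hφ f₀ hf₀
  simp only [hφ_apply, map_one, map_mul, hΦ₀, star_one, h1, star_zero, mul_zero, zero_mul, mul_one,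
    one_mul, add_zero, hx.star_eq, hstar] at h
  rw [add_comm (x * T x), ← two_smul ℂ, ← two_smul ℂ (T x * x + x * T x)] at h
  exact smul_right_injective A two_ne_zero h

/-- A linear map preserving self-adjointness and satisfying the Jordan derivation identity on
self-adjoint elements is a triple derivation. -/
lemma triple_derivation_of_jordan (T : A →ₗ[ℂ] A)
    (h : ∀ x : A, IsSelfAdjoint x → star (T x) = T x ∧ T (x * x) = T x * x + x * T x)
    (a b c : A) : T (trip a b c) = trip (T a) b c + trip a (T b) c + trip a b (T c) := by
  have hsa : ∀ x y : A, IsSelfAdjoint x → IsSelfAdjoint y →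
      T (x * y + y * x) = T x * y + x * T y + (T y * x + y * T x) := by
    intro x y hx hy
    have h3 := (h _ (hx.add hy)).2
    simp only [mul_add, add_mul, map_add, (h x hx).2, (h y hy).2] at h3
    rw [map_add]
    rw [← sub_eq_zero] at h3 ⊢
    rw [← h3]
    abel
  have hdec : ∀ a : A, ∃ x y : A, IsSelfAdjoint x ∧ IsSelfAdjoint y ∧ a = x + Complex.I • y :=
    fun a => ⟨realPart a, imaginaryPart a, (realPart a).2, (imaginaryPart a).2,
      (realPart_add_I_smul_imaginaryPart a).symm⟩
  have hstar : ∀ a, T (star a) = star (T a) := by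
    intro a
    obtain ⟨x, y, hx, hy, rfl⟩ := hdec a
    simp [hx.star_eq, hy.star_eq, (h x hx).1, (h y hy).1]
  have hJ : ∀ a b : A, T (a * b + b * a) = T a * b + a * T b + (T b * a + b * T a) := by
    intro a b
    obtain ⟨x, y, hx, hy, rfl⟩ := hdec a
    obtain ⟨u, v, hu, hv, rfl⟩ := hdec b
    have e1 := hsa x u hx hu
    have e2 := hsa x v hx hv
    have e3 := hsa y u hy hu
    have e4 := hsa y v hy hv
    have e : (x + Complex.I • y) * (u + Complex.I • v) + (u + Complex.I • v) * (x + Complex.I • y)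
        = (x * u + u * x) + Complex.I • (x * v + v * x) + Complex.I • (y * u + u * y)
          + (Complex.I * Complex.I) • (y * v + v * y) := by
      simp only [mul_add, add_mul, smul_mul_assoc, mul_smul_comm]
      module
    rw [e]
    simp only [map_add T (_ + _), map_smul, map_add T _ (_ • _)]
    simp only [e1, e2, e3, e4]
    simp only [mul_add, add_mul, smul_mul_assoc, mul_smul_comm]
    module
  have hid : ∀ a b c : A, trip a b c = (4 : ℂ)⁻¹ •
      (((a * star b + star b * a) * c + c * (a * star b + star b * a))
        + ((c * star b + star b * c) * a + a * (c * star b + star b * c))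
        - ((a * c + c * a) * star b + star b * (a * c + c * a))) := by
    intro a b c
    simp only [trip, mul_add, add_mul, mul_assoc]
    module
  rw [hid a b c, map_smul, map_sub, map_add, hJ, hJ, hJ, hJ, hJ, hJ, hstar]
  simp only [trip, mul_add, add_mul, mul_assoc]
  module

lemma trip_mul_left_of_skew {h : A} (hh : star h = -h) (a b c : A) :
    h * trip a b c = trip (h * a) b c + trip a (h * b) c + trip a b (h * c) := by
  simp only [trip, star_mul, hh, mul_add, mul_smul_comm, mul_neg, neg_mul, mul_assoc]
  module

end CStarAlgebra

/-- A bounded linear map `T` on a unital C*-algebra which is a triple derivation at zero and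
satisfies `T(1)* = -T(1)` is a triple derivation. -/
theorem stmt10 {A : Type*} [CStarAlgebra A] (T : A →ₗ[ℂ] A) (hcont : Continuous T)
    (hT : ∀ a b c : A, trip a b c = 0 →
      trip (T a) b c + trip a (T b) c + trip a b (T c) = 0)
    (h1 : star (T 1) = - T 1) :
    ∀ a b c : A, T (trip a b c) = trip (T a) b c + trip a (T b) c + trip a b (T c) := by
  intro a b c
  let S : A →ₗ[ℂ] A := T - LinearMap.mulLeft ℂ (T 1)
  have hS : ∀ a, S a = T a - T 1 * a := fun _ => rfl
  have hsplit : ∀ a b c : A, trip (S a) b c + trip a (S b) c + trip a b (S c) =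
      trip (T a) b c + trip a (T b) c + trip a b (T c) - T 1 * trip a b c := by
    intro a b c
    rw [trip_mul_left_of_skew h1]
    simp only [trip, hS, star_sub, mul_sub, sub_mul]
    module
  have hmain := triple_derivation_of_jordan S
    (jordan_of_triple_derivation_at_zero S
      (by
        change Continuous fun a => T a - T 1 * a
        fun_prop)
      (fun a b c habc => by rw [hsplit, hT a b c habc, habc, mul_zero, sub_zero])
      (by rw [hS, mul_one, sub_self])) a b c
  rw [hsplit, hS] at hmain
  exact sub_left_injective hmain
end

section
/- Let M be a von Neumann algebra and let T : M → M be a linear map such that aT(b)c = 0 whenever a, b, c ∈ M satisfy ab = bc = 0 and the six elements a, a*, b, b*, c, c* pairwise commute (equivalently, whenever a, b, c lie in a commutative von Neumann subalgebra of M and ab = bc = 0). Then T is continuous. -/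
open Filter Topology

/-- A continuous function on `ℝ` which differs from the identity by a bounded periodic function
and is locally constant away from `⋃ n : ℤ, [n - 1 / 4, n]`. -/
noncomputable def staircase (y : ℝ) : ℝ := y + max (-Int.fract y) (3 * Int.fract y - 3)

lemma continuous_staircase : Continuous staircase := by
  have h : Continuous ((fun s : ℝ ↦ max (-s) (3 * s - 3)) ∘ Int.fract) :=
    ContinuousOn.comp_fract'' (by fun_prop) (by norm_num)
  exact continuous_id.add h

lemma abs_staircase_sub_le (y : ℝ) : |staircase y - y| ≤ 1 := by
  have h0 := Int.fract_nonneg y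
  have h1 := Int.fract_lt_one y
  simp only [staircase, add_sub_cancel_left]
  rw [abs_le]
  constructor
  · exact le_max_of_le_left (by linarith)
  · exact max_le (by linarith) (by linarith)

lemma staircase_eventuallyEq {y : ℝ} (h0 : 0 < Int.fract y) (h1 : Int.fract y < 3 / 4) :
    ∀ᶠ z in 𝓝 y, staircase z = ⌊y⌋ := by
  have hy := Int.floor_add_fract y
  filter_upwards [Ioo_mem_nhds (show (⌊y⌋ : ℝ) < y by linarith)
    (show y < ⌊y⌋ + 3 / 4 by linarith)] with z hz
  have hfl : ⌊z⌋ = ⌊y⌋ := Int.floor_eq_iff.2 ⟨hz.1.le, by linarith [hz.2]⟩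
  have hfr : Int.fract z = z - ⌊y⌋ := by rw [← hfl]; rfl
  rw [staircase, hfr, max_eq_left (by linarith [hz.2])]
  ring

/-- The function `t ↦ t * staircase (θ - log |t|)` is continuous, also at `0`. -/
lemma continuous_mul_staircase_log (θ : ℝ) :
    Continuous fun t : ℝ ↦ t * staircase (θ - Real.log t) := by
  have key : Continuous fun t : ℝ ↦
      t * (staircase (θ - Real.log t) - (θ - Real.log t)) := by
    rw [continuous_iff_continuousAt]
    intro t
    by_cases ht : t = 0
    · subst ht
      rw [ContinuousAt, zero_mul]
      refine squeeze_zero_norm (a := fun t ↦ |t|) (fun t ↦ ?_)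
        (by simpa using continuous_abs.tendsto (0 : ℝ))
      rw [Real.norm_eq_abs, abs_mul]
      exact mul_le_of_le_one_right (abs_nonneg _) (abs_staircase_sub_le _)
    · have h1 : ContinuousAt (fun t ↦ θ - Real.log t) t :=
        continuousAt_const.sub (Real.continuousAt_log ht)
      exact continuousAt_id.mul ((continuous_staircase.continuousAt.comp h1).sub h1)
  have h2 : Continuous fun t : ℝ ↦ θ * t - t * Real.log t :=
    (continuous_const.mul continuous_id).sub Real.continuous_mul_log
  refine (key.add h2).congr fun t ↦ ?_
  simp only [Pi.add_apply]
  ring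

/-- There are two continuous functions such that near every small nonzero point one of them is a
homothety, whose ratio tends to infinity as the point tends to zero. -/
lemma exists_continuous_locally_homothety : ∃ g₁ g₂ : ℝ → ℝ, Continuous g₁ ∧ Continuous g₂ ∧
    ∀ K : ℝ, ∃ δ > 0, ∀ r : ℝ, r ≠ 0 → |r| < δ → ∃ s ≥ K,
      (∀ᶠ t in 𝓝 r, g₁ t = s * t) ∨ ∀ᶠ t in 𝓝 r, g₂ t = s * t := by
  have flat (θ r : ℝ) (hr : r ≠ 0) (h0 : 0 < Int.fract (θ - Real.log r))
      (h1 : Int.fract (θ - Real.log r) < 3 / 4) :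
      ∀ᶠ t in 𝓝 r, t * staircase (θ - Real.log t) = ⌊θ - Real.log r⌋ * t := by
    have hc : ContinuousAt (fun t ↦ θ - Real.log t) r :=
      continuousAt_const.sub (Real.continuousAt_log hr)
    filter_upwards [hc.eventually (staircase_eventuallyEq h0 h1)] with t ht
    rw [ht, mul_comm]
  refine ⟨_, _, continuous_mul_staircase_log 0, continuous_mul_staircase_log (1 / 2),
    fun K ↦ ⟨Real.exp (-(K + 1)), Real.exp_pos _, fun r hr hrd ↦ ?_⟩⟩
  have hlog : Real.log r < -(K + 1) := by
    rw [← Real.log_abs, Real.log_lt_iff_lt_exp (abs_pos.2 hr)]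
    exact hrd
  have hf0 := Int.fract_nonneg (0 - Real.log r)
  have hf1 := Int.fract_lt_one (0 - Real.log r)
  have hf := Int.floor_add_fract (0 - Real.log r)
  by_cases h : 0 < Int.fract (0 - Real.log r) ∧ Int.fract (0 - Real.log r) < 3 / 4
  · exact ⟨⌊0 - Real.log r⌋, by linarith, Or.inl (flat 0 r hr h.1 h.2)⟩
  · have hh : 0 < Int.fract (1 / 2 - Real.log r) ∧ Int.fract (1 / 2 - Real.log r) < 3 / 4 := by
      rcases eq_or_lt_of_le hf0 with h0 | h0
      · have : Int.fract (1 / 2 - Real.log r) = 1 / 2 :=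
          Int.fract_eq_iff.2 ⟨by norm_num, by norm_num, ⌊0 - Real.log r⌋, by linarith⟩
        rw [this]
        norm_num
      · have h3 : 3 / 4 ≤ Int.fract (0 - Real.log r) := by
          by_contra! h4
          exact h ⟨h0, h4⟩
        have : Int.fract (1 / 2 - Real.log r) = Int.fract (0 - Real.log r) - 1 / 2 :=
          Int.fract_eq_iff.2 ⟨by linarith, by linarith, ⌊0 - Real.log r⌋ + 1, by
            push_cast
            linarith⟩
        rw [this]
        constructor <;> linarith
    have hf' := Int.floor_add_fract (1 / 2 - Real.log r)
    exact ⟨⌊1 / 2 - Real.log r⌋, by linarith [hh.2], Or.inr (flat (1 / 2) r hr hh.1 hh.2)⟩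

/-- A linear map on a Banach space which does not decrease the norm when added, with any
coefficient, to the identity is continuous. -/
lemma LinearMap.continuous_of_norm_le_norm_add_smul {E : Type*} [NormedAddCommGroup E]
    [NormedSpace ℝ E] [CompleteSpace E] (D : E →ₗ[ℝ] E)
    (hD : ∀ (x : E) (t : ℝ), ‖x‖ ≤ ‖x + t • D x‖) : Continuous D := by
  have zero_graph (u : ℕ → E) (y : E) (hu : Tendsto u atTop (𝓝 0))
      (hDu : Tendsto (fun n ↦ D (u n)) atTop (𝓝 y)) : y = 0 := by
    have key (z : E) (t : ℝ) (ht : t ≠ 0) : ‖z‖ ≤ ‖z + t • D z + y‖ := by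
      have h1 : Tendsto (fun n ↦ ‖z + t⁻¹ • u n‖) atTop (𝓝 ‖z + t⁻¹ • (0 : E)‖) :=
        (tendsto_const_nhds.add (hu.const_smul _)).norm
      have h2 : Tendsto (fun n ↦ ‖z + t⁻¹ • u n + (t • D z + D (u n))‖) atTop
          (𝓝 ‖z + t⁻¹ • (0 : E) + (t • D z + y)‖) :=
        ((tendsto_const_nhds.add (hu.const_smul _)).add (tendsto_const_nhds.add hDu)).norm
      have h3 := le_of_tendsto_of_tendsto' h1 h2 fun n ↦ by
        have := hD (z + t⁻¹ • u n) t
        rwa [map_add, map_smul, smul_add, smul_inv_smul₀ ht] at this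
      simpa [add_assoc] using h3
    have h4 : Tendsto (fun t : ℝ ↦ ‖-y + t • D (-y) + y‖) (𝓝[≠] 0)
        (𝓝 ‖-y + (0 : ℝ) • D (-y) + y‖) :=
      (by fun_prop : Continuous fun t : ℝ ↦ ‖-y + t • D (-y) + y‖).continuousAt.tendsto.mono_left
        nhdsWithin_le_nhds
    have h5 : ‖-y‖ ≤ ‖-y + (0 : ℝ) • D (-y) + y‖ :=
      ge_of_tendsto h4 (by filter_upwards [self_mem_nhdsWithin] with t ht using key _ t ht)
    simpa using h5
  refine D.continuous_of_seq_closed_graph fun u x y hu hDu ↦ ?_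
  have h : y - D x = 0 := zero_graph (fun n ↦ u n - x) _
    (by simpa using hu.sub_const x) (by simpa using hDu.sub_const (D x))
  exact sub_eq_zero.1 h

section CStarAlgebra

variable {A : Type*} [CStarAlgebra A] {T : A →ₗ[ℂ] A}

/-- The condition `a * T b * c = 0` for `a`, `b`, `c` such that `a * b = b * c = 0` and `a`, `b`,
`c` and their adjoints commute. -/
def VanishesOnCommutingOrthogonal (T : A →ₗ[ℂ] A) : Prop :=
  ∀ a b c : A, a * b = 0 → b * c = 0 →
    (∀ x ∈ ({a, star a, b, star b, c, star c} : Set A),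
      ∀ y ∈ ({a, star a, b, star b, c, star c} : Set A), x * y = y * x) →
    a * T b * c = 0

namespace VanishesOnCommutingOrthogonal

lemma cfc_mul_map_cfc_mul_cfc (hT : VanishesOnCommutingOrthogonal T) {k : A}
    {f h : ℝ → ℝ} (hf : ContinuousOn f (spectrum ℝ k)) (hh : ContinuousOn h (spectrum ℝ k))
    (hfh : ∀ t ∈ spectrum ℝ k, f t * h t = 0) :
    cfc f k * T (cfc h k) * cfc f k = 0 := by
  have h0 : cfc f k * cfc h k = 0 := by
    rw [← cfc_mul f h k, cfc_congr (g := fun _ ↦ 0) hfh, cfc_const_zero]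
  have hsf : star (cfc f k) = cfc f k := (cfc_predicate f k : IsSelfAdjoint _).star_eq
  have hsh : star (cfc h k) = cfc h k := (cfc_predicate h k : IsSelfAdjoint _).star_eq
  have hcomm : cfc f k * cfc h k = cfc h k * cfc f k := cfc_commute_cfc f h k
  refine hT _ _ _ h0 (hcomm ▸ h0) ?_
  rw [hsf, hsh]
  rintro x (rfl | rfl | rfl | rfl | rfl | rfl) y (rfl | rfl | rfl | rfl | rfl | rfl) <;>
    first | rfl | exact hcomm | exact hcomm.symm

/-- If `h` vanishes near a point `r` of the spectrum of `k`, then `T (h k)` is compressed to zero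
by some element concentrated near `r`. -/
lemma exists_mul_map_cfc_mul_eq_zero (hT : VanishesOnCommutingOrthogonal T) {k : A}
    (hk : IsSelfAdjoint k) {r : ℝ} (hr : r ∈ spectrum ℝ k) {h : ℝ → ℝ}
    (hh : Continuous h) (hz : ∀ᶠ t in 𝓝[spectrum ℝ k] r, h t = 0) {ε : ℝ} (hε : 0 < ε) :
    ∃ c : A, IsSelfAdjoint c ∧ ‖c‖ = 1 ∧ ‖c * (k - algebraMap ℝ A r) * c‖ ≤ ε ∧
      c * T (cfc h k) * c = 0 := by
  obtain ⟨δ, hδ, hzδ⟩ := Metric.mem_nhdsWithin_iff.1 hz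
  set ρ := min δ ε
  have hρ0 : 0 < ρ := lt_min hδ hε
  obtain ⟨f, hf, hf0, hf1, hfr, hfρ⟩ : ∃ f : ℝ → ℝ, Continuous f ∧ (∀ t, 0 ≤ f t) ∧
      (∀ t, f t ≤ 1) ∧ f r = 1 ∧ ∀ t, ρ ≤ |t - r| → f t = 0 :=
    ⟨fun t ↦ max 0 (1 - |t - r| / ρ), by fun_prop, fun t ↦ le_max_left _ _,
      fun t ↦ max_le zero_le_one (sub_le_self _ (by positivity)), by simp, fun t ht ↦
      max_eq_left (by rw [sub_nonpos, one_le_div hρ0]; exact ht)⟩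
  have hnorm : ‖cfc f k‖ ≤ 1 := norm_cfc_le zero_le_one fun t _ ↦ by
    rw [Real.norm_of_nonneg (hf0 t)]
    exact hf1 t
  have hcomp : cfc f k * (k - algebraMap ℝ A r) = cfc (fun t ↦ f t * (t - r)) k := by
    rw [cfc_mul f (fun t ↦ t - r) k hf.continuousOn, cfc_sub (fun t ↦ t) (fun _ ↦ r) k, cfc_id' ℝ k,
      cfc_const r k]
  refine ⟨cfc f k, cfc_predicate f k, le_antisymm hnorm ?_, ?_,
    hT.cfc_mul_map_cfc_mul_cfc hf.continuousOn hh.continuousOn fun t ht ↦ ?_⟩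
  · simpa [hfr] using norm_apply_le_norm_cfc f k hr hf.continuousOn
  · have h1 : ‖cfc f k * (k - algebraMap ℝ A r)‖ ≤ ε := by
      rw [hcomp]
      refine norm_cfc_le hε.le fun t _ ↦ ?_
      rw [norm_mul, Real.norm_of_nonneg (hf0 t), Real.norm_eq_abs]
      rcases le_total ρ |t - r| with hle | hle
      · rw [hfρ t hle, zero_mul]
        exact hε.le
      · exact (mul_le_of_le_one_left (abs_nonneg _) (hf1 t)).trans
          (hle.trans (min_le_right _ _))
    calc _ ≤ ‖cfc f k * (k - algebraMap ℝ A r)‖ * ‖cfc f k‖ := norm_mul_le _ _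
      _ ≤ ε * 1 := by gcongr
      _ = ε := mul_one ε
  · rcases le_or_gt ρ |t - r| with hle | hlt
    · rw [hfρ t hle, zero_mul]
    · have : h t = 0 := hzδ ⟨by
        rw [Metric.mem_ball, Real.dist_eq]
        exact hlt.trans_le (min_le_left _ _), ht⟩
      rw [this, mul_zero]

/-- A non-invertible self-adjoint element and its image under `T` are simultaneously made small by
compressions of norm one. -/
lemma exists_norm_mul_mul_le (hT : VanishesOnCommutingOrthogonal T) {k : A}
    (hk : IsSelfAdjoint k) (h0 : (0 : ℝ) ∈ spectrum ℝ k) {ε : ℝ} (hε : 0 < ε) :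
    ∃ c : A, IsSelfAdjoint c ∧ ‖c‖ = 1 ∧ ‖c * k * c‖ ≤ ε ∧ ‖c * T k * c‖ ≤ ε := by
  by_cases hiso : ∀ᶠ t in 𝓝[spectrum ℝ k] 0, t = 0
  · obtain ⟨c, hc, hc1, hck, hcT⟩ :=
      hT.exists_mul_map_cfc_mul_eq_zero hk h0 (h := fun t ↦ t) continuous_id hiso hε
    rw [cfc_id' ℝ k] at hcT
    exact ⟨c, hc, hc1, by simpa using hck, by rw [hcT, norm_zero]; exact hε.le⟩
  obtain ⟨g₁, g₂, hg₁, hg₂, hg⟩ := exists_continuous_locally_homothety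
  set C := ‖T (cfc g₁ k)‖ + ‖T (cfc g₂ k)‖ with hC
  obtain ⟨δ, hδ, hδg⟩ := hg (C / ε + 1)
  obtain ⟨r, hr, hrs, hrd⟩ : ∃ r : ℝ, r ≠ 0 ∧ r ∈ spectrum ℝ k ∧ |r| < min δ (ε / 2) := by
    by_contra! hcon
    refine hiso (Metric.mem_nhdsWithin_iff.2 ⟨min δ (ε / 2), by positivity, fun t ht ↦ ?_⟩)
    by_contra ht0
    have := hcon t ht0 ht.2
    exact this.not_gt (by simpa [Real.dist_eq] using ht.1)
  obtain ⟨s, hs, hgs⟩ := hδg r hr (hrd.trans_le (min_le_left _ _))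
  obtain ⟨g, hgc, hgr, hgC⟩ : ∃ g : ℝ → ℝ, Continuous g ∧ (∀ᶠ t in 𝓝 r, g t = s * t) ∧
      ‖T (cfc g k)‖ ≤ C := by
    rcases hgs with h | h
    · exact ⟨g₁, hg₁, h, by simp [hC]⟩
    · exact ⟨g₂, hg₂, h, by simp [hC]⟩
  obtain ⟨c, hc, hc1, hck, hcT⟩ := hT.exists_mul_map_cfc_mul_eq_zero hk hrs
    (h := fun t ↦ g t - s * t) (by fun_prop)
    ((hgr.filter_mono nhdsWithin_le_nhds).mono fun t ht ↦ sub_eq_zero.2 ht) (half_pos hε)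
  have hcomp (y : A) : ‖c * y * c‖ ≤ ‖y‖ := by
    calc ‖c * y * c‖ ≤ ‖c‖ * ‖y‖ * ‖c‖ := norm_mul₃_le
      _ = ‖y‖ := by rw [hc1, one_mul, mul_one]
  refine ⟨c, hc, hc1, ?_, ?_⟩
  · have hsplit : c * k * c = c * (k - algebraMap ℝ A r) * c + c * algebraMap ℝ A r * c := by
      noncomm_ring
    have hrr : ‖c * algebraMap ℝ A r * c‖ ≤ ε / 2 := by
      rw [Algebra.algebraMap_eq_smul_one, mul_smul_comm, mul_one, smul_mul_assoc, norm_smul,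
        Real.norm_eq_abs]
      calc |r| * ‖c * c‖ ≤ |r| * (‖c‖ * ‖c‖) := by gcongr; exact norm_mul_le _ _
        _ ≤ ε / 2 := by
          rw [hc1, mul_one, mul_one]
          exact (hrd.trans_le (min_le_right _ _)).le
    rw [hsplit]
    linarith [norm_add_le (c * (k - algebraMap ℝ A r) * c) (c * algebraMap ℝ A r * c)]
  · have hTeq : c * T (cfc g k) * c = (s : ℂ) • (c * T k * c) := by
      rw [cfc_sub g (fun t ↦ s * t) k, cfc_const_mul_id s k, map_sub, mul_sub, sub_mul,
        sub_eq_zero] at hcT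
      rw [hcT, ← Complex.coe_smul, map_smul, mul_smul_comm, smul_mul_assoc]
    have hs0 : 0 < s := lt_of_lt_of_le (by positivity) hs
    have h1 : s * ‖c * T k * c‖ ≤ C := by
      have := (hcomp (T (cfc g k))).trans hgC
      rwa [hTeq, norm_smul, Complex.norm_real, Real.norm_of_nonneg hs0.le] at this
    have h2 : C ≤ s * ε := by
      rw [← div_le_iff₀ hε]
      linarith
    exact le_of_mul_le_mul_left (h1.trans h2) hs0

lemma norm_le_norm_add_smul_realPart [Nontrivial A] (hT : VanishesOnCommutingOrthogonal T)
    (hT1 : T 1 = 0) (x : selfAdjoint A) (t : ℝ) :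
    ‖x‖ ≤ ‖x + t • realPart (T (x : A))‖ := by
  obtain ⟨r, hr, hrx⟩ : ∃ r ∈ spectrum ℝ (x : A), |r| = ‖x‖ := by
    rcases CStarAlgebra.norm_or_neg_norm_mem_spectrum x.2 with h | h
    · exact ⟨_, h, by simp⟩
    · exact ⟨_, h, by simp⟩
  set k : A := x - algebraMap ℝ A r with hkdef
  have hk : IsSelfAdjoint k := x.2.sub (.algebraMap A (.all r))
  have hk0 : (0 : ℝ) ∈ spectrum ℝ k := by
    rw [hkdef, ← sub_self r, ← spectrum.sub_singleton_eq]
    exact Set.sub_mem_sub hr rfl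
  have hTk : T k = T x := by
    rw [hkdef, map_sub, Algebra.algebraMap_eq_smul_one, ← Complex.coe_smul, map_smul, hT1,
      smul_zero, sub_zero]
  refine le_of_forall_pos_le_add fun ε hε ↦ ?_
  set η := ε / (1 + |t|) with hη
  obtain ⟨c, hc, hc1, hck, hcT⟩ := hT.exists_norm_mul_mul_le hk hk0 (ε := η) (by positivity)
  have hcR : ‖c * (realPart (T (x : A)) : A) * c‖ ≤ η := by
    have heq : c * (realPart (T (x : A)) : A) * c =
        (realPart (c * T (x : A) * c) : A) := by
      simp only [realPart_apply_coe, star_mul, hc.star_eq, mul_smul_comm, smul_mul_assoc,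
        mul_add, add_mul, mul_assoc]
    rw [heq, AddSubgroup.norm_coe]
    exact (realPart.norm_le _).trans (hTk ▸ hcT)
  have hcc : ‖c * c‖ = 1 := by
    rw [hc.norm_mul_self, hc1, one_pow]
  have hsplit : r • (c * c) = c * (x + t • (realPart (T (x : A)) : A)) * c - c * k * c -
      t • (c * (realPart (T (x : A)) : A) * c) := by
    simp only [hkdef, Algebra.algebraMap_eq_smul_one, mul_add, add_mul, mul_sub, sub_mul,
      mul_smul_comm, smul_mul_assoc, mul_one]
    abel
  have hcomp : ‖c * (x + t • (realPart (T (x : A)) : A)) * c‖ ≤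
      ‖x + t • realPart (T (x : A))‖ := by
    calc _ ≤ ‖c‖ * ‖(x : A) + t • (realPart (T (x : A)) : A)‖ * ‖c‖ := norm_mul₃_le
      _ = _ := by rw [hc1, one_mul, mul_one]; rfl
  calc ‖x‖ = ‖r • (c * c)‖ := by rw [norm_smul, hcc, mul_one, Real.norm_eq_abs, hrx]
    _ ≤ ‖c * (x + t • (realPart (T (x : A)) : A)) * c‖ + ‖c * k * c‖ +
        ‖t • (c * (realPart (T (x : A)) : A) * c)‖ := by
      rw [hsplit]
      exact (norm_sub_le _ _).trans (by gcongr; exact norm_sub_le _ _)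
    _ ≤ ‖x + t • realPart (T (x : A))‖ + η + |t| * η := by
      rw [norm_smul, Real.norm_eq_abs]
      gcongr
    _ = ‖x + t • realPart (T (x : A))‖ + ε := by
      rw [hη]
      field_simp
      ring

lemma continuous_realPart_comp (hT : VanishesOnCommutingOrthogonal T) (hT1 : T 1 = 0) :
    Continuous fun x : selfAdjoint A ↦ realPart (T (x : A)) := by
  nontriviality A
  have : CompleteSpace (selfAdjoint A) :=
    (isClosed_eq continuous_star continuous_id :
      IsClosed {x : A | star x = x}).completeSpace_coe
  let D : selfAdjoint A →ₗ[ℝ] selfAdjoint A :=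
    realPart ∘ₗ T.restrictScalars ℝ ∘ₗ (selfAdjoint.submodule ℝ A).subtype
  exact D.continuous_of_norm_le_norm_add_smul (hT.norm_le_norm_add_smul_realPart hT1)

lemma smul (hT : VanishesOnCommutingOrthogonal T) (z : ℂ) :
    VanishesOnCommutingOrthogonal (z • T) := fun a b c hab hbc h ↦ by
  rw [LinearMap.smul_apply, mul_smul_comm, smul_mul_assoc, hT a b c hab hbc h, smul_zero]

lemma sub_mulLeft (hT : VanishesOnCommutingOrthogonal T) (y : A) :
    VanishesOnCommutingOrthogonal (T - LinearMap.mulLeft ℂ y) := fun a b c hab hbc h ↦ by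
  rw [LinearMap.sub_apply, LinearMap.mulLeft_apply, mul_sub, sub_mul, hT a b c hab hbc h,
    mul_assoc, mul_assoc, hbc, mul_zero, mul_zero, sub_zero]

lemma continuous_of_map_one (hT : VanishesOnCommutingOrthogonal T) (hT1 : T 1 = 0) :
    Continuous T := by
  have hre := hT.continuous_realPart_comp hT1
  have him := (hT.smul (-Complex.I)).continuous_realPart_comp (by simp [hT1])
  have hsa : Continuous fun x : selfAdjoint A ↦ T (x : A) := by
    have h : Continuous fun x : selfAdjoint A ↦ (realPart (T (x : A)) : A) +
        Complex.I • (realPart ((-Complex.I • T) (x : A)) : A) :=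
      (continuous_subtype_val.comp hre).add ((continuous_subtype_val.comp him).const_smul _)
    refine h.congr fun x ↦ ?_
    conv_rhs => rw [← realPart_add_I_smul_imaginaryPart (T (x : A))]
    rw [LinearMap.smul_apply, neg_smul, map_neg, realPart_I_smul, neg_neg]
  have hRe : Continuous (realPart : A → selfAdjoint A) :=
    AddMonoidHomClass.continuous_of_bound realPart 1 fun x ↦ by simpa using realPart.norm_le x
  have hIm : Continuous (imaginaryPart : A → selfAdjoint A) :=
    AddMonoidHomClass.continuous_of_bound imaginaryPart 1 fun x ↦ by
      simpa using imaginaryPart.norm_le x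
  refine ((hsa.comp hRe).add ((hsa.comp hIm).const_smul Complex.I)).congr fun x ↦ ?_
  conv_rhs => rw [← realPart_add_I_smul_imaginaryPart x, map_add, map_smul]
  rfl

protected theorem continuous (hT : VanishesOnCommutingOrthogonal T) : Continuous T := by
  have h := (hT.sub_mulLeft (T 1)).continuous_of_map_one (by simp)
  refine (h.add (continuous_const_mul (T 1))).congr fun x ↦ ?_
  simp

end VanishesOnCommutingOrthogonal

end CStarAlgebra

lemma VonNeumannAlgebra.isClosed_toStarSubalgebra {H : Type*} [NormedAddCommGroup H]
    [InnerProductSpace ℂ H] [CompleteSpace H] (M : VonNeumannAlgebra H) :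
    IsClosed (M.toStarSubalgebra : Set (H →L[ℂ] H)) := by
  rw [VonNeumannAlgebra.coe_toStarSubalgebra, ← M.centralizer_centralizer]
  exact Set.isClosed_centralizer _

/-- Let `T` be a linear map on a von Neumann algebra `M` such that `a T(b) c = 0` whenever
`a, b, c ∈ M` satisfy `ab = bc = 0` and the six elements `a, a*, b, b*, c, c*` pairwise
commute. Then `T` is continuous. -/
theorem stmt11 {H : Type*} [NormedAddCommGroup H] [InnerProductSpace ℂ H] [CompleteSpace H]
    (M : VonNeumannAlgebra H)
    (T : M.toStarSubalgebra →ₗ[ℂ] M.toStarSubalgebra)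
    (hT : ∀ a b c : M.toStarSubalgebra, a * b = 0 → b * c = 0 →
      (∀ x ∈ ({a, star a, b, star b, c, star c} : Set M.toStarSubalgebra),
        ∀ y ∈ ({a, star a, b, star b, c, star c} : Set M.toStarSubalgebra), x * y = y * x) →
      a * T b * c = 0) :
    Continuous T := by
  have : IsClosed (M.toStarSubalgebra : Set (H →L[ℂ] H)) := M.isClosed_toStarSubalgebra
  exact VanishesOnCommutingOrthogonal.continuous (T := T) hT
end
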